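/- arXiv:2012.14598 — 4 statements merged into one kernel-verified Lean document; each statement's English description precedes it below -/
import Mathlib

section
/- (a) If β < 2, then for each i ∈ {1,2,3}, almost surely lim_{n→∞} ℙ(S_{n+1}^i − S_n^i = 1 | 𝒜_n) = 1/2. (b) There exists β_0 such that for all β ≥ β_0, with positive probability there exist two indices i ≠ j with lim_{n→∞} S_n^i = +∞ and lim_{n→∞} S_n^j = −∞, and the remaining index k satisfies lim_{n→∞} ℙ(S_{n+1}^k − S_n^k = 1 | 𝒜_n) = 1/2. -/
open Filter MeasureTheory

/-- `μ(y) = 1/(1 + exp(β y))`. -/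
noncomputable def muFun (β y : ℝ) : ℝ := 1 / (1 + Real.exp (β * y))

/-- The conditional probability `ℙ(S_{n+1}^i = S_n^i + 1 | 𝒜_n)`, as a random variable. -/
noncomputable def upProb {Ω : Type*} (mΩ : MeasurableSpace Ω) (ℙ : @Measure Ω mΩ)
    (𝒜 : Filtration ℕ mΩ) (S : ℕ → Ω → Fin 3 → ℤ) (n : ℕ) (i : Fin 3) : Ω → ℝ :=
  ℙ[(fun ω => if S (n + 1) ω i = S n ω i + 1 then (1 : ℝ) else 0) | 𝒜 n]

/-- The model of three repelling random walks on `ℤ`: increments are `±1`; `𝒜` is the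
natural filtration; at time `0` each walk steps up with probability `1/2`; for `n ≥ 1`
walk `i` steps up with conditional probability `μ(Σ_{j ≠ i} (S_n^j - S_0^j)/n)`; and the
three increments are conditionally independent given `𝒜_n`. -/
def Setup (β : ℝ) {Ω : Type*} (mΩ : MeasurableSpace Ω) (ℙ : @Measure Ω mΩ)
    (𝒜 : Filtration ℕ mΩ) (S : ℕ → Ω → Fin 3 → ℤ) : Prop :=
  (∀ n, @Measurable Ω _ mΩ _ (S n)) ∧
  (∀ n ω i, S (n + 1) ω i - S n ω i = 1 ∨ S (n + 1) ω i - S n ω i = -1) ∧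
  (∀ n, 𝒜 n = ⨆ k ∈ Finset.Icc 1 n, MeasurableSpace.comap (S k) ⊤) ∧
  (∀ i, upProb mΩ ℙ 𝒜 S 0 i =ᵐ[ℙ] fun _ => 1 / 2) ∧
  (∀ n, 1 ≤ n → ∀ i, upProb mΩ ℙ 𝒜 S n i =ᵐ[ℙ] fun ω =>
    muFun β (∑ j ∈ Finset.univ.erase i, ((S n ω j - S 0 ω j : ℤ) : ℝ) / n)) ∧
  (∀ n, 1 ≤ n → ∀ ε : Fin 3 → ℤ, (∀ i, ε i = 1 ∨ ε i = -1) →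
    (ℙ[(fun ω => if (∀ i, S (n + 1) ω i = S n ω i + ε i) then (1 : ℝ) else 0) | 𝒜 n])
      =ᵐ[ℙ] fun ω => ∏ i,
        (if ε i = 1 then
          muFun β (∑ j ∈ Finset.univ.erase i, ((S n ω j - S 0 ω j : ℤ) : ℝ) / n)
        else
          1 - muFun β (∑ j ∈ Finset.univ.erase i, ((S n ω j - S 0 ω j : ℤ) : ℝ) / n)))

/-- Pull-out property in integrated form. -/
theorem integral_mul_eq_of_condExp_ae_eq {Ω : Type*} {m mΩ : MeasurableSpace Ω} {ℙ : Measure Ω}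
    [IsProbabilityMeasure ℙ] (hm : m ≤ mΩ) {h w f : Ω → ℝ} {M : ℝ}
    (hh : AEStronglyMeasurable[m] h ℙ) (hM : ∀ᵐ ω ∂ℙ, ‖h ω‖ ≤ M) (hw : Integrable w ℙ)
    (hf : ℙ[w | m] =ᵐ[ℙ] f) :
    ∫ ω, h ω * w ω ∂ℙ = ∫ ω, h ω * f ω ∂ℙ := by
  have hint : Integrable (h * w) ℙ := hw.bdd_mul (hh.mono hm) hM
  have h1 := condExp_mul_of_aestronglyMeasurable_left hh hint hw
  have h2 : ∫ ω, (ℙ[h * w | m]) ω ∂ℙ = ∫ ω, (h * w) ω ∂ℙ := integral_condExp hm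
  calc ∫ ω, h ω * w ω ∂ℙ = ∫ ω, (ℙ[h * w | m]) ω ∂ℙ := h2.symm
    _ = ∫ ω, h ω * f ω ∂ℙ := by
      apply integral_congr_ae
      filter_upwards [h1, hf] with ω h1 hf
      rw [h1, Pi.mul_apply, hf]

/-- A nonnegative sequence with increments `O(1/n)` that is summable against `1/n` tends to `0`. -/
theorem tendsto_zero_of_summable_div {v : ℕ → ℝ} {C : ℝ} {N : ℕ} (hv : ∀ n, 0 ≤ v n)
    (hC : ∀ n, |v (n + 1) - v n| ≤ C / ((N + n : ℕ) + 1))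
    (hs : Summable fun n : ℕ => v n / ((N + n : ℕ) + 1 : ℝ)) :
    Tendsto v atTop (nhds 0) := by
  have hC0 : 0 ≤ C := by
    have := (abs_nonneg _).trans (hC 0)
    by_contra! hneg
    have := div_neg_of_neg_of_pos hneg (by positivity : (0 : ℝ) < ((N + 0 : ℕ) : ℝ) + 1)
    linarith
  have hsq : Summable fun n : ℕ => 1 / (((N + n : ℕ) : ℝ) + 1) ^ 2 := by
    have h0 : Summable fun n : ℕ => 1 / (n : ℝ) ^ 2 := Real.summable_one_div_nat_pow.2 (by norm_num)
    have := h0.comp_injective (i := fun n : ℕ => N + n + 1) (fun a b hab => by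
      simp only at hab; omega)
    refine this.congr fun n => ?_
    simp
  have hd : Summable fun n => dist (v n ^ 2) (v (n + 1) ^ 2) := by
    refine Summable.of_nonneg_of_le (fun _ => dist_nonneg) (fun n => ?_)
      ((hs.mul_left (2 * C)).add (hsq.mul_left (C ^ 2)))
    set t : ℝ := ((N + n : ℕ) : ℝ) + 1 with ht
    have ht0 : 0 < t := by positivity
    have h1 : dist (v n ^ 2) (v (n + 1) ^ 2) = |v (n + 1) - v n| * (v (n + 1) + v n) := by
      rw [dist_comm, Real.dist_eq, ← abs_of_nonneg (add_nonneg (hv (n + 1)) (hv n)), ← abs_mul]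
      congr 1
      ring
    have h2 : v (n + 1) + v n ≤ 2 * v n + C / t := by
      have := (abs_le.1 (hC n)).2
      linarith
    calc dist (v n ^ 2) (v (n + 1) ^ 2) = |v (n + 1) - v n| * (v (n + 1) + v n) := h1
      _ ≤ C / t * (2 * v n + C / t) :=
        mul_le_mul (hC n) h2 (add_nonneg (hv _) (hv _)) (by positivity)
      _ = 2 * C * (v n / t) + C ^ 2 * (1 / t ^ 2) := by field_simp
  obtain ⟨L, hL⟩ := cauchySeq_tendsto_of_complete (cauchySeq_of_summable_dist hd)
  have hL0 : 0 ≤ L := ge_of_tendsto' hL fun n => sq_nonneg _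
  have hvL : Tendsto v atTop (nhds (Real.sqrt L)) := by
    have := (Real.continuous_sqrt.tendsto L).comp hL
    refine this.congr fun n => ?_
    simp [Real.sqrt_sq (hv n)]
  rcases (Real.sqrt_nonneg L).eq_or_lt with h0 | hpos
  · rwa [← h0] at hvL
  exfalso
  have hev : ∀ᶠ n in atTop, Real.sqrt L / 2 < v n :=
    hvL.eventually (lt_mem_nhds (by linarith))
  obtain ⟨k, hk⟩ := eventually_atTop.1 hev
  have hs1 := hs.comp_injective (i := fun n : ℕ => k + n) (fun a b hab => by
    simp only at hab; omega)
  have hs2 : Summable fun n : ℕ => Real.sqrt L / 2 * (1 / ((N + (k + n) : ℕ) + 1 : ℝ)) := by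
    refine Summable.of_nonneg_of_le (fun n => by positivity) (fun n => ?_) hs1
    have := hk (k + n) (by omega)
    simp only [Function.comp]
    rw [mul_one_div]
    gcongr
  have hs3 := (summable_mul_left_iff (by positivity : Real.sqrt L / 2 ≠ 0)).1 hs2
  refine Real.not_summable_one_div_natCast ((summable_nat_add_iff (N + k + 1)).1 ?_)
  refine hs3.congr fun n => ?_
  push_cast
  congr 1
  ring

/-- `x` is a `[-1, 1]^ι`-valued stochastic approximation with gains `1 / (n + 1)`: `x (n + 1)` moves
from `x n` towards the innovation `w n`, whose conditional mean is `F (x n)`. -/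
structure IsStochasticApproximation {Ω ι : Type*} [Fintype ι] {mΩ : MeasurableSpace Ω}
    (ℙ : Measure Ω) (𝒜 : Filtration ℕ mΩ) (F : (ι → ℝ) → ι → ℝ) (x w : ℕ → Ω → ι → ℝ) : Prop where
  state_mem : ∀ n, 1 ≤ n → ∀ ω, x n ω ∈ Set.Icc (-1) 1
  innovation_mem : ∀ n ω, w n ω ∈ Set.Icc (-1) 1
  step : ∀ n, 1 ≤ n → ∀ ω, x (n + 1) ω = x n ω + (1 / ((n : ℝ) + 1)) • (w n ω - x n ω)
  state_meas : ∀ n, 1 ≤ n → AEStronglyMeasurable[𝒜 n] (x n) ℙ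
  innovation_meas : ∀ n, Measurable (w n)
  condExp : ∀ n, 1 ≤ n → ∀ i, ℙ[fun ω => w n ω i | 𝒜 n] =ᵐ[ℙ] fun ω => F (x n ω) i

/-- `V`, with gradient `D`, is a Lyapunov function with rate `δ` on its sublevel set `{V < r}` for
the mean dynamics `ẋ = F x - x` on the cube `[-1, 1]^ι`. -/
structure IsLyapunov {ι : Type*} [Fintype ι] (F : (ι → ℝ) → ι → ℝ) (V : (ι → ℝ) → ℝ)
    (D : (ι → ℝ) → ι → ℝ) (δ C r : ℝ) : Prop where
  continuous : Continuous V
  continuous_grad : Continuous D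
  nonneg : ∀ x, 0 ≤ V x
  taylor : ∀ x ∈ Set.Icc (-1 : ι → ℝ) 1, ∀ w ∈ Set.Icc (-1 : ι → ℝ) 1, ∀ h ∈ Set.Icc (0 : ℝ) 1,
    V (x + h • (w - x)) ≤ V x + h * ∑ i, D x i * (w i - x i) + C * h ^ 2
  lipschitz : ∀ x ∈ Set.Icc (-1 : ι → ℝ) 1, ∀ w ∈ Set.Icc (-1 : ι → ℝ) 1,
    ∀ h ∈ Set.Icc (0 : ℝ) 1, |V (x + h • (w - x)) - V x| ≤ C * h
  drift : ∀ x ∈ Set.Icc (-1 : ι → ℝ) 1, V x < r → ∑ i, D x i * (F x i - x i) ≤ -δ * V x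

/-- Nonnegative functions with summable integrals are almost surely summable. -/
theorem ae_summable_of_summable_integral {Ω : Type*} {mΩ : MeasurableSpace Ω} {ℙ : Measure Ω}
    {f : ℕ → Ω → ℝ} (hf : ∀ m, Integrable (f m) ℙ)
    (hf0 : ∀ m ω, 0 ≤ f m ω) (hs : Summable fun m => ∫ ω, f m ω ∂ℙ) :
    ∀ᵐ ω ∂ℙ, Summable fun m => f m ω := by
  have hfin : ∫⁻ ω, ∑' m, ENNReal.ofReal (f m ω) ∂ℙ ≠ ⊤ := by
    rw [lintegral_tsum fun m => (hf m).aemeasurable.ennreal_ofReal]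
    simp_rw [← ofReal_integral_eq_lintegral_ofReal (hf _) (Eventually.of_forall (hf0 _))]
    exact hs.tsum_ofReal_ne_top
  filter_upwards [ae_lt_top' (AEMeasurable.tsum fun m =>
    (hf m).aemeasurable.ennreal_ofReal) hfin] with ω hω
  refine (ENNReal.summable_toReal hω.ne).congr fun m => ?_
  exact ENNReal.toReal_ofReal (hf0 m ω)

section Alive

variable {Ω ι : Type*} {V : (ι → ℝ) → ℝ} {r : ℝ} {x : ℕ → Ω → ι → ℝ}

open Classical in
/-- Indicator of the event `A` intersected with the event that `V (x m) < r` for all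
`N ≤ m ≤ N + k`. -/
noncomputable def alive (V : (ι → ℝ) → ℝ) (r : ℝ) (x : ℕ → Ω → ι → ℝ) (A : Set Ω) (N k : ℕ)
    (ω : Ω) : ℝ :=
  if ω ∈ A ∧ ∀ m ≤ k, V (x (N + m) ω) < r then 1 else 0

theorem alive_nonneg (A : Set Ω) (N k : ℕ) (ω : Ω) : 0 ≤ alive V r x A N k ω := by
  unfold alive; split_ifs <;> norm_num

theorem alive_le_one (A : Set Ω) (N k : ℕ) (ω : Ω) : alive V r x A N k ω ≤ 1 := by
  unfold alive; split_ifs <;> norm_num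

theorem of_alive_ne_zero {A : Set Ω} {N k : ℕ} {ω : Ω} (h : alive V r x A N k ω ≠ 0) :
    ω ∈ A ∧ ∀ m ≤ k, V (x (N + m) ω) < r := by
  by_contra h'
  exact h (if_neg h')

theorem alive_succ_le (A : Set Ω) (N k : ℕ) (ω : Ω) :
    alive V r x A N (k + 1) ω ≤ alive V r x A N k ω := by
  by_cases h : alive V r x A N (k + 1) ω = 0
  · rw [h]; exact alive_nonneg _ _ _ _
  · obtain ⟨h1, h2⟩ := of_alive_ne_zero h
    rw [show alive V r x A N k ω = 1 from if_pos ⟨h1, fun m hm => h2 m (by omega)⟩]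
    exact alive_le_one _ _ _ _

end Alive

section StochasticApproximation

variable {Ω ι : Type*} [Fintype ι] {mΩ : MeasurableSpace Ω} {ℙ : Measure Ω}
  {𝒜 : Filtration ℕ mΩ} {F : (ι → ℝ) → ι → ℝ} {x w : ℕ → Ω → ι → ℝ}
  {V : (ι → ℝ) → ℝ} {D : (ι → ℝ) → ι → ℝ} {δ C r : ℝ}

theorem IsStochasticApproximation.exists_bound (hx : IsStochasticApproximation ℙ 𝒜 F x w)
    {φ : (ι → ℝ) → ℝ} (hφ : Continuous φ) : ∃ M, ∀ n, 1 ≤ n → ∀ ω, ‖φ (x n ω)‖ ≤ M := by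
  obtain ⟨M, hM⟩ := (isCompact_Icc (a := (-1 : ι → ℝ)) (b := 1)).exists_bound_of_continuousOn
    hφ.continuousOn
  exact ⟨M, fun n hn ω => hM _ (hx.state_mem n hn ω)⟩

theorem IsStochasticApproximation.integrable_mul (hx : IsStochasticApproximation ℙ 𝒜 F x w)
    {φ : (ι → ℝ) → ℝ} (hφ : Continuous φ) {n : ℕ} (hn : 1 ≤ n) {H : Ω → ℝ}
    (hH : Integrable H ℙ) : Integrable (fun ω => H ω * φ (x n ω)) ℙ := by
  obtain ⟨M, hM⟩ := hx.exists_bound hφ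
  exact hH.mul_bdd (((hφ.comp_aestronglyMeasurable (hx.state_meas n hn))).mono (𝒜.le n))
    (Eventually.of_forall fun ω => hM n hn ω)

theorem aestronglyMeasurable_alive (hx : IsStochasticApproximation ℙ 𝒜 F x w) (hV : Continuous V)
    {N : ℕ} (hN : 1 ≤ N) {A : Set Ω} (hA : MeasurableSet[𝒜 N] A) (k : ℕ) :
    AEStronglyMeasurable[𝒜 (N + k)] (alive V r x A N k) ℙ := by
  classical
  choose! y hym hy using fun m (hm : 1 ≤ m) => hV.comp_aestronglyMeasurable (hx.state_meas m hm)
  let G : Set Ω := A ∩ ⋂ m ∈ Finset.range (k + 1), {ω | y (N + m) ω < r}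
  have hG : MeasurableSet[𝒜 (N + k)] G := by
    refine MeasurableSet.inter (𝒜.mono (by omega) _ hA) ?_
    refine Finset.measurableSet_biInter _ fun m hm => ?_
    refine 𝒜.mono (i := N + m) (by have := Finset.mem_range.1 hm; omega) _ ?_
    exact (hym (N + m) (by omega)).measurable measurableSet_Iio
  refine ⟨G.indicator fun _ => 1, stronglyMeasurable_const.indicator hG, ?_⟩
  have hall : ∀ᵐ ω ∂ℙ, ∀ m, 1 ≤ m → V (x m ω) = y m ω := by
    rw [ae_all_iff]
    intro m
    by_cases hm : 1 ≤ m
    · filter_upwards [hy m hm] with ω h _ using h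
    · exact Eventually.of_forall fun ω h => absurd h hm
  filter_upwards [hall] with ω h
  unfold alive
  rw [Set.indicator_apply]
  congr 1
  simp only [G, Set.mem_inter_iff, Set.mem_iInter, Finset.mem_range, Set.mem_ofPred_eq, eq_iff_iff,
    Nat.lt_succ_iff]
  refine and_congr_right fun _ => forall₂_congr fun m _ => ?_
  rw [h (N + m) (by omega)]

variable [IsProbabilityMeasure ℙ]

theorem IsStochasticApproximation.integral_mul_innovation_sub
    (hx : IsStochasticApproximation ℙ 𝒜 F x w) (hF : Continuous F)
    {φ : (ι → ℝ) → ℝ} (hφ : Continuous φ) {n : ℕ} (hn : 1 ≤ n) {H : Ω → ℝ}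
    (hHm : AEStronglyMeasurable[𝒜 n] H ℙ) (hH1 : ∀ ω, ‖H ω‖ ≤ 1) (i : ι) :
    Integrable (fun ω => H ω * φ (x n ω) * (w n ω i - F (x n ω) i)) ℙ ∧
      ∫ ω, H ω * φ (x n ω) * (w n ω i - F (x n ω) i) ∂ℙ = 0 := by
  obtain ⟨M, hM⟩ := hx.exists_bound hφ
  have hHi : Integrable H ℙ := .of_bound (hHm.mono (𝒜.le n)) 1 (Eventually.of_forall hH1)
  have hwm : AEStronglyMeasurable (fun ω => w n ω i) ℙ :=
    ((measurable_pi_apply i).comp (hx.innovation_meas n)).aestronglyMeasurable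
  have hw1 : ∀ ω, ‖w n ω i‖ ≤ 1 := fun ω =>
    abs_le.2 ⟨(hx.innovation_mem n ω).1 i, (hx.innovation_mem n ω).2 i⟩
  have hwi : Integrable (fun ω => w n ω i) ℙ := .of_bound hwm 1 (Eventually.of_forall hw1)
  have h1 : Integrable (fun ω => H ω * φ (x n ω) * w n ω i) ℙ :=
    (hx.integrable_mul hφ hn hHi).mul_bdd hwm (Eventually.of_forall hw1)
  have h2 : Integrable (fun ω => H ω * φ (x n ω) * F (x n ω) i) ℙ :=
    hx.integrable_mul ((continuous_apply i).comp hF) hn (hx.integrable_mul hφ hn hHi)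
  have h3 := integral_mul_eq_of_condExp_ae_eq (𝒜.le n) (h := fun ω => H ω * φ (x n ω)) (M := 1 * M)
    (hHm.mul (hφ.comp_aestronglyMeasurable (hx.state_meas n hn)))
    (Eventually.of_forall fun ω => by
      rw [norm_mul]
      exact mul_le_mul (hH1 ω) (hM n hn ω) (norm_nonneg _) zero_le_one) hwi (hx.condExp n hn i)
  simp_rw [mul_sub]
  exact ⟨h1.sub h2, by rw [integral_sub h1 h2, h3, sub_self]⟩

theorem IsLyapunov.const_nonneg (hV : IsLyapunov F V D δ C r) : 0 ≤ C := by
  have := (abs_nonneg _).trans (hV.lipschitz 0 ⟨fun _ => by simp, fun _ => by simp⟩ 0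
    ⟨fun _ => by simp, fun _ => by simp⟩ 1 ⟨by simp, le_rfl⟩)
  simpa using this

theorem one_div_natCast_add_one_mem_Icc (n : ℕ) : 1 / ((n : ℝ) + 1) ∈ Set.Icc (0 : ℝ) 1 :=
  ⟨by positivity, by rw [div_le_one (by positivity)]; simp⟩

/-- Expected decrease of the Lyapunov function on an event known at time `n`. -/
theorem IsLyapunov.integral_step_le (hV : IsLyapunov F V D δ C r)
    (hx : IsStochasticApproximation ℙ 𝒜 F x w) (hF : Continuous F) {n : ℕ} (hn : 1 ≤ n) {H : Ω → ℝ}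
    (hHm : AEStronglyMeasurable[𝒜 n] H ℙ) (hH0 : ∀ ω, 0 ≤ H ω) (hH1 : ∀ ω, H ω ≤ 1)
    (hHr : ∀ ω, H ω ≠ 0 → V (x n ω) < r) :
    ∫ ω, H ω * V (x (n + 1) ω) ∂ℙ ≤ ∫ ω, H ω * V (x n ω) ∂ℙ
      - δ / (n + 1) * ∫ ω, H ω * V (x n ω) ∂ℙ + C / (n + 1) ^ 2 * ∫ ω, H ω ∂ℙ := by
  have hHn : ∀ ω, ‖H ω‖ ≤ 1 := fun ω => by
    rw [Real.norm_eq_abs, abs_of_nonneg (hH0 ω)]; exact hH1 ω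
  have hHi : Integrable H ℙ := .of_bound (hHm.mono (𝒜.le n)) 1 (Eventually.of_forall hHn)
  have hHV := hx.integrable_mul hV.continuous hn hHi
  have hD : ∀ i, Continuous fun y => D y i := fun i => (continuous_apply i).comp hV.continuous_grad
  set h : ℝ := 1 / ((n : ℝ) + 1) with hh
  have hmart := fun i => hx.integral_mul_innovation_sub hF (hD i) hn hHm hHn i
  have hsum : ∫ ω, ∑ i, H ω * D (x n ω) i * (w n ω i - F (x n ω) i) ∂ℙ = 0 := by
    rw [integral_finsetSum _ fun i _ => (hmart i).1]
    exact Finset.sum_eq_zero fun i _ => (hmart i).2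
  have hsumi : Integrable (fun ω => ∑ i, H ω * D (x n ω) i * (w n ω i - F (x n ω) i)) ℙ :=
    integrable_finsetSum _ fun i _ => (hmart i).1
  have hA : Integrable (fun ω => H ω * V (x n ω) - δ * h * (H ω * V (x n ω))) ℙ :=
    hHV.sub (hHV.const_mul _)
  have hB : Integrable (fun ω => H ω * V (x n ω) - δ * h * (H ω * V (x n ω))
      + C * h ^ 2 * H ω) ℙ := hA.add (hHi.const_mul _)
  calc ∫ ω, H ω * V (x (n + 1) ω) ∂ℙ
      ≤ ∫ ω, (H ω * V (x n ω) - δ * h * (H ω * V (x n ω)) + C * h ^ 2 * H ω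
        + h * ∑ i, H ω * D (x n ω) i * (w n ω i - F (x n ω) i)) ∂ℙ := by
        refine integral_mono (hx.integrable_mul hV.continuous (by omega) hHi)
          (hB.add (hsumi.const_mul h)) fun ω => ?_
        rcases eq_or_ne (H ω) 0 with h0 | h0
        · simp [h0]
        have ht := hV.taylor _ (hx.state_mem n hn ω) _ (hx.innovation_mem n ω) h
          (one_div_natCast_add_one_mem_Icc n)
        rw [← hx.step n hn ω] at ht
        have hd := mul_le_mul_of_nonneg_left (hV.drift _ (hx.state_mem n hn ω) (hHr ω h0))
          (one_div_natCast_add_one_mem_Icc n).1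
        have hsplit : ∑ i, D (x n ω) i * (w n ω i - x n ω i)
            = ∑ i, D (x n ω) i * (w n ω i - F (x n ω) i)
              + ∑ i, D (x n ω) i * (F (x n ω) i - x n ω i) := by
          rw [← Finset.sum_add_distrib]
          exact Finset.sum_congr rfl fun i _ => by ring
        have hout : ∑ i, H ω * D (x n ω) i * (w n ω i - F (x n ω) i)
            = H ω * ∑ i, D (x n ω) i * (w n ω i - F (x n ω) i) := by
          rw [Finset.mul_sum]
          exact Finset.sum_congr rfl fun i _ => by ring
        simp only [hout]
        rw [hsplit] at ht
        calc H ω * V (x (n + 1) ω) ≤ H ω * (V (x n ω)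
              + h * ∑ i, D (x n ω) i * (w n ω i - F (x n ω) i) + h * (-δ * V (x n ω))
              + C * h ^ 2) := by
              refine mul_le_mul_of_nonneg_left ?_ (hH0 ω)
              rw [← hh] at hd
              linarith
          _ = _ := by ring
    _ = _ := by
        rw [integral_add hB (hsumi.const_mul h), integral_add hA (hHi.const_mul _),
          integral_sub hHV (hHV.const_mul _), integral_const_mul, integral_const_mul,
          integral_const_mul, hsum, hh]
        field_simp
        ring

theorem integrable_alive (hx : IsStochasticApproximation ℙ 𝒜 F x w) (hV : Continuous V)
    {N : ℕ} (hN : 1 ≤ N) {A : Set Ω} (hA : MeasurableSet[𝒜 N] A) (k : ℕ) :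
    Integrable (alive V r x A N k) ℙ := by
  refine .of_bound ((aestronglyMeasurable_alive hx hV hN hA k).mono (𝒜.le _)) 1
    (Eventually.of_forall fun ω => ?_)
  rw [Real.norm_eq_abs, abs_of_nonneg (alive_nonneg _ _ _ _)]
  exact alive_le_one _ _ _ _

/-- Telescoped Lyapunov inequality for the process killed upon leaving `{V < r}`. -/
theorem IsLyapunov.sum_add_exit_le (hV : IsLyapunov F V D δ C r)
    (hx : IsStochasticApproximation ℙ 𝒜 F x w) (hF : Continuous F)
    {N : ℕ} (hN : 1 ≤ N) {A : Set Ω} (hA : MeasurableSet[𝒜 N] A) (k : ℕ) :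
    δ * ∑ m ∈ Finset.range k,
        (∫ ω, alive V r x A N m ω * V (x (N + m) ω) ∂ℙ) / ((N + m : ℕ) + 1)
      + r * (∫ ω, alive V r x A N 0 ω ∂ℙ - ∫ ω, alive V r x A N k ω ∂ℙ)
      + ∫ ω, alive V r x A N k ω * V (x (N + k) ω) ∂ℙ
      + C * (∫ ω, alive V r x A N 0 ω ∂ℙ) / (N + k : ℕ)
    ≤ ∫ ω, alive V r x A N 0 ω * V (x N ω) ∂ℙ + C * (∫ ω, alive V r x A N 0 ω ∂ℙ) / N := by
  have hint := fun k => integrable_alive (r := r) hx hV.continuous hN hA k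
  have hanti : Antitone fun k => ∫ ω, alive V r x A N k ω ∂ℙ :=
    antitone_nat_of_succ_le fun k => integral_mono (hint _) (hint _) (alive_succ_le A N k)
  induction k with
  | zero => simp
  | succ k ih =>
    have hstep := hV.integral_step_le hx hF (n := N + k) (by omega)
      (aestronglyMeasurable_alive hx hV.continuous hN hA k) (alive_nonneg A N k)
      (alive_le_one A N k) (fun ω h => (of_alive_ne_zero h).2 k le_rfl)
    have hexit : ∫ ω, alive V r x A N (k + 1) ω * V (x (N + (k + 1)) ω) ∂ℙ
        + r * (∫ ω, alive V r x A N k ω ∂ℙ - ∫ ω, alive V r x A N (k + 1) ω ∂ℙ)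
        ≤ ∫ ω, alive V r x A N k ω * V (x (N + k + 1) ω) ∂ℙ := by
      have hi1 := hx.integrable_mul hV.continuous (n := N + (k + 1)) (by omega) (hint (k + 1))
      have hi2 : Integrable (fun ω => r * (alive V r x A N k ω - alive V r x A N (k + 1) ω)) ℙ :=
        ((hint k).sub (hint (k + 1))).const_mul r
      rw [← integral_sub (hint k) (hint (k + 1)), ← integral_const_mul, ← integral_add hi1 hi2]
      refine integral_mono (hi1.add hi2)
        (hx.integrable_mul hV.continuous (n := N + k + 1) (by omega) (hint k)) fun ω => ?_
      simp only
      by_cases h1 : alive V r x A N (k + 1) ω = 0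
      · by_cases h0 : alive V r x A N k ω = 0
        · simp [h0, h1]
        · obtain ⟨hA', h2⟩ := of_alive_ne_zero h0
          have h3 : alive V r x A N k ω = 1 := if_pos ⟨hA', h2⟩
          have h4 : r ≤ V (x (N + k + 1) ω) := by
            by_contra! h5
            have h6 : alive V r x A N (k + 1) ω = 1 := by
              refine if_pos ⟨hA', fun m hm => ?_⟩
              rcases Nat.le_succ_iff.1 hm with hm | rfl
              · exact h2 m hm
              · exact h5
            exact one_ne_zero (h6.symm.trans h1)
          rw [h1, h3]
          linarith
      · obtain ⟨hA', h2⟩ := of_alive_ne_zero h1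
        have h3 : alive V r x A N k ω = 1 := if_pos ⟨hA', fun m hm => h2 m (by omega)⟩
        have h4 : alive V r x A N (k + 1) ω = 1 := if_pos ⟨hA', h2⟩
        rw [h3, h4]
        simp [add_assoc]
    have hq : ∫ ω, alive V r x A N k ω ∂ℙ ≤ ∫ ω, alive V r x A N 0 ω ∂ℙ := hanti (Nat.zero_le k)
    have hq0 : 0 ≤ ∫ ω, alive V r x A N 0 ω ∂ℙ := integral_nonneg (alive_nonneg A N 0)
    have hn : (1 : ℝ) ≤ (N + k : ℕ) := by exact_mod_cast (by omega : 1 ≤ N + k)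
    have hC := hV.const_nonneg
    have htel : C / (((N + k : ℕ) : ℝ) + 1) ^ 2 * ∫ ω, alive V r x A N k ω ∂ℙ
        ≤ C * (∫ ω, alive V r x A N 0 ω ∂ℙ) / (N + k : ℕ)
          - C * (∫ ω, alive V r x A N 0 ω ∂ℙ) / (N + (k + 1) : ℕ) := by
      have hrec : 1 / (((N + k : ℕ) : ℝ) + 1) ^ 2
          ≤ 1 / ((N + k : ℕ) : ℝ) - 1 / (((N + k : ℕ) : ℝ) + 1) := by
        rw [div_sub_div _ _ (by positivity) (by positivity), div_le_div_iff₀ (by positivity)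
          (by positivity)]
        nlinarith
      calc C / (((N + k : ℕ) : ℝ) + 1) ^ 2 * ∫ ω, alive V r x A N k ω ∂ℙ
          ≤ C / (((N + k : ℕ) : ℝ) + 1) ^ 2 * ∫ ω, alive V r x A N 0 ω ∂ℙ := by gcongr
        _ = C * (∫ ω, alive V r x A N 0 ω ∂ℙ) * (1 / (((N + k : ℕ) : ℝ) + 1) ^ 2) := by ring
        _ ≤ C * (∫ ω, alive V r x A N 0 ω ∂ℙ)
            * (1 / ((N + k : ℕ) : ℝ) - 1 / (((N + k : ℕ) : ℝ) + 1)) := by gcongr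
        _ = _ := by push_cast; ring
    rw [Finset.sum_range_succ, mul_add]
    have hcomm : δ * ((∫ ω, alive V r x A N k ω * V (x (N + k) ω) ∂ℙ) / (((N + k : ℕ) : ℝ) + 1))
        = δ / (((N + k : ℕ) : ℝ) + 1) * ∫ ω, alive V r x A N k ω * V (x (N + k) ω) ∂ℙ := by ring
    rw [hcomm]
    linarith

/-- A stochastic approximation that stays in the domain of a Lyapunov function converges to the zero
set of that function. -/
theorem IsLyapunov.ae_tendsto_zero (hV : IsLyapunov F V D δ C r) (hδ : 0 < δ) (hr : 0 ≤ r)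
    (hx : IsStochasticApproximation ℙ 𝒜 F x w) (hF : Continuous F)
    {N : ℕ} (hN : 1 ≤ N) {A : Set Ω} (hA : MeasurableSet[𝒜 N] A) :
    ∀ᵐ ω ∂ℙ, ω ∈ A → (∀ m, V (x (N + m) ω) < r) → Tendsto (fun n => V (x n ω)) atTop (nhds 0) := by
  have hint := fun k => integrable_alive (r := r) hx hV.continuous hN hA k
  have hanti : Antitone fun k => ∫ ω, alive V r x A N k ω ∂ℙ :=
    antitone_nat_of_succ_le fun k => integral_mono (hint _) (hint _) (alive_succ_le A N k)
  have he0 : ∀ k, 0 ≤ ∫ ω, alive V r x A N k ω * V (x (N + k) ω) ∂ℙ := fun k =>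
    integral_nonneg fun ω => mul_nonneg (alive_nonneg A N k ω) (hV.nonneg _)
  have hq0 : 0 ≤ ∫ ω, alive V r x A N 0 ω ∂ℙ := integral_nonneg (alive_nonneg A N 0)
  have hsum : Summable fun m =>
      (∫ ω, alive V r x A N m ω * V (x (N + m) ω) ∂ℙ) / ((N + m : ℕ) + 1 : ℝ) := by
    refine summable_of_sum_range_le (c := (∫ ω, alive V r x A N 0 ω * V (x N ω) ∂ℙ
      + C * (∫ ω, alive V r x A N 0 ω ∂ℙ) / N) / δ)
      (fun m => div_nonneg (he0 m) (by positivity)) fun k => ?_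
    rw [le_div_iff₀' hδ]
    have h1 := hV.sum_add_exit_le hx hF hN hA k
    have h2 := mul_nonneg hr (sub_nonneg.2 (hanti (Nat.zero_le k)))
    have h3 : 0 ≤ C * (∫ ω, alive V r x A N 0 ω ∂ℙ) / (N + k : ℕ) :=
      div_nonneg (mul_nonneg hV.const_nonneg hq0) (Nat.cast_nonneg _)
    have h4 := he0 k
    simp only at h2
    linarith
  simp_rw [← integral_div] at hsum
  have hae := ae_summable_of_summable_integral
    (fun m => (hx.integrable_mul hV.continuous (n := N + m) (by omega) (hint m)).div_const _)
    (fun m ω => div_nonneg (mul_nonneg (alive_nonneg A N m ω) (hV.nonneg _)) (by positivity)) hsum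
  filter_upwards [hae] with ω hω hωA hωr
  have hω' : Summable fun m : ℕ => V (x (N + m) ω) / ((N + m : ℕ) + 1 : ℝ) := by
    refine hω.congr fun m => ?_
    rw [show alive V r x A N m ω = 1 from if_pos ⟨hωA, fun m _ => hωr m⟩, one_mul]
  have hlim := tendsto_zero_of_summable_div (v := fun m => V (x (N + m) ω)) (C := C)
    (fun m => hV.nonneg _) (fun m => ?_) hω'
  · rw [← tendsto_add_atTop_iff_nat N]
    simpa only [add_comm] using hlim
  · have := hV.lipschitz _ (hx.state_mem (N + m) (by omega) ω) _ (hx.innovation_mem (N + m) ω) _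
      (one_div_natCast_add_one_mem_Icc (N + m))
    rw [← hx.step (N + m) (by omega) ω, mul_one_div] at this
    exact this

/-- A stochastic approximation that starts late and deep inside the domain of a Lyapunov function
stays there forever with positive probability. -/
theorem IsLyapunov.measure_forall_lt_pos (hV : IsLyapunov F V D δ C r) (hδ : 0 < δ) (hr : 0 < r)
    (hx : IsStochasticApproximation ℙ 𝒜 F x w) (hF : Continuous F)
    {N : ℕ} (hN : 1 ≤ N) (hCN : C / N ≤ r / 4) {A : Set Ω} (hA : MeasurableSet[𝒜 N] A)
    (hA0 : 0 < ℙ A) (hAV : ∀ ω ∈ A, V (x N ω) ≤ r / 4) :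
    0 < ℙ {ω | ω ∈ A ∧ ∀ m, V (x (N + m) ω) < r} := by
  classical
  have hint := fun k => integrable_alive (r := r) hx hV.continuous hN hA k
  have he0 : ∀ k, 0 ≤ ∫ ω, alive V r x A N k ω * V (x (N + k) ω) ∂ℙ := fun k =>
    integral_nonneg fun ω => mul_nonneg (alive_nonneg A N k ω) (hV.nonneg _)
  have halive0 : alive V r x A N 0 = A.indicator fun _ => 1 := by
    ext ω
    unfold alive
    rw [Set.indicator_apply]
    congr 1
    simp only [Nat.le_zero, forall_eq, add_zero, eq_iff_iff, and_iff_left_iff_imp]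
    exact fun h => (hAV ω h).trans_lt (by linarith)
  have hq0 : 0 < ∫ ω, alive V r x A N 0 ω ∂ℙ := by
    rw [halive0, integral_indicator_const _ ((𝒜.le N) _ hA), smul_eq_mul, mul_one]
    exact ENNReal.toReal_pos hA0.ne' (measure_ne_top _ _)
  set q := ∫ ω, alive V r x A N 0 ω ∂ℙ with hq
  have hstart : ∫ ω, alive V r x A N 0 ω * V (x N ω) ∂ℙ ≤ r / 4 * q := by
    rw [hq, ← integral_const_mul]
    refine integral_mono (hx.integrable_mul hV.continuous hN (hint 0)) ((hint 0).const_mul _)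
      fun ω => ?_
    by_cases h : alive V r x A N 0 ω = 0
    · simp [h]
    · have := mul_le_mul_of_nonneg_left (hAV ω (of_alive_ne_zero h).1) (alive_nonneg (V := V)
        (r := r) (x := x) A N 0 ω)
      simp only
      linarith
  have hlow : ∀ k, q / 2 ≤ ∫ ω, alive V r x A N k ω ∂ℙ := fun k => by
    have h1 := hV.sum_add_exit_le hx hF hN hA k
    rw [← hq] at h1
    have h2 : 0 ≤ δ * ∑ m ∈ Finset.range k,
        (∫ ω, alive V r x A N m ω * V (x (N + m) ω) ∂ℙ) / ((N + m : ℕ) + 1 : ℝ) :=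
      mul_nonneg hδ.le (Finset.sum_nonneg fun m _ => div_nonneg (he0 m) (by positivity))
    have h3 : 0 ≤ C * q / (N + k : ℕ) :=
      div_nonneg (mul_nonneg hV.const_nonneg hq0.le) (Nat.cast_nonneg _)
    have h4 : C * q / N ≤ r / 4 * q := by
      rw [mul_div_right_comm]
      exact mul_le_mul_of_nonneg_right hCN hq0.le
    have h5 := he0 k
    have h6 : r * (q - ∫ ω, alive V r x A N k ω ∂ℙ) ≤ r * (q / 2) := by linarith
    have := le_of_mul_le_mul_left h6 hr
    linarith
  set G : Set Ω := {ω | ω ∈ A ∧ ∀ m, V (x (N + m) ω) < r} with hG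
  have hlim : Tendsto (fun k => ∫ ω, alive V r x A N k ω ∂ℙ) atTop
      (nhds (∫ ω, G.indicator (fun _ => (1 : ℝ)) ω ∂ℙ)) := by
    refine tendsto_integral_of_dominated_convergence (fun _ => 1)
      (fun k => (hint k).aestronglyMeasurable) (integrable_const 1)
      (fun k => Eventually.of_forall fun ω => ?_) (Eventually.of_forall fun ω => ?_)
    · rw [Real.norm_eq_abs, abs_of_nonneg (alive_nonneg A N k ω)]
      exact alive_le_one A N k ω
    · refine tendsto_const_nhds.congr' ?_
      by_cases hω : ω ∈ G
      · refine Eventually.of_forall fun k => ?_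
        rw [Set.indicator_of_mem hω]
        exact (if_pos ⟨hω.1, fun m _ => hω.2 m⟩).symm
      · rw [Set.indicator_of_notMem hω]
        by_cases hωA : ω ∈ A
        · obtain ⟨m, hm⟩ : ∃ m, ¬ V (x (N + m) ω) < r := by
            by_contra! h
            exact hω ⟨hωA, h⟩
          filter_upwards [eventually_ge_atTop m] with k hk
          exact (if_neg fun h => hm (h.2 m hk)).symm
        · exact Eventually.of_forall fun k => (if_neg fun h => hωA h.1).symm
  by_contra h0
  have hG0 : ℙ G = 0 := by simpa using h0
  have hzero : ∫ ω, G.indicator (fun _ => (1 : ℝ)) ω ∂ℙ = 0 :=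
    integral_eq_zero_of_ae (indicator_meas_zero hG0)
  have := ge_of_tendsto' hlim hlow
  rw [hzero] at this
  linarith

end StochasticApproximation

theorem muFun_pos (β y : ℝ) : 0 < muFun β y := by
  unfold muFun; positivity

theorem muFun_lt_one (β y : ℝ) : muFun β y < 1 := by
  unfold muFun
  rw [div_lt_one (by positivity)]
  linarith [Real.exp_pos (β * y)]

theorem continuous_muFun (β : ℝ) : Continuous (muFun β) := by
  unfold muFun
  exact continuous_const.div (by fun_prop) fun y => by positivity

theorem muFun_zero (β : ℝ) : muFun β 0 = 1 / 2 := by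
  norm_num [muFun]

theorem muFun_neg (β y : ℝ) : muFun β (-y) = 1 - muFun β y := by
  unfold muFun
  rw [mul_neg, Real.exp_neg]
  have := Real.exp_pos (β * y)
  field_simp
  ring

theorem log_one_div_muFun_sub_one {β : ℝ} (hβ : 0 < β) (y : ℝ) :
    Real.log (1 / muFun β y - 1) / β = y := by
  unfold muFun
  rw [one_div_one_div, add_sub_cancel_left, Real.log_exp]
  field_simp

theorem hasDerivAt_muFun (β y : ℝ) :
    HasDerivAt (muFun β) (-(β * Real.exp (β * y) / (1 + Real.exp (β * y)) ^ 2)) y := by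
  have h1 : HasDerivAt (fun y => 1 + Real.exp (β * y)) (Real.exp (β * y) * (β * 1)) y :=
    (((hasDerivAt_id y).const_mul β).exp).const_add 1
  have h2 := h1.inv (by positivity)
  refine (h2.congr_deriv (by ring)).congr_of_eventuallyEq (Eventually.of_forall fun z => ?_)
  simp [muFun]

/-- The secant slopes of `muFun β` are values of its derivative. -/
theorem exists_muFun_sub_eq (β s t : ℝ) : ∃ y, min s t ≤ y ∧
    muFun β s - muFun β t = -(β * Real.exp (β * y) / (1 + Real.exp (β * y)) ^ 2) * (s - t) := by
  rcases lt_trichotomy s t with h | rfl | h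
  · obtain ⟨y, hy, he⟩ := exists_hasDerivAt_eq_slope (muFun β) _ h
      (continuous_muFun β).continuousOn fun y _ => hasDerivAt_muFun β y
    refine ⟨y, (min_le_left s t).trans hy.1.le, ?_⟩
    rw [he]
    have : t - s ≠ 0 := by linarith
    field_simp
    ring
  · exact ⟨s, min_le_left s s, by simp⟩
  · obtain ⟨y, hy, he⟩ := exists_hasDerivAt_eq_slope (muFun β) _ h
      (continuous_muFun β).continuousOn fun y _ => hasDerivAt_muFun β y
    refine ⟨y, (min_le_right s t).trans hy.1.le, ?_⟩
    rw [he]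
    have : s - t ≠ 0 := by linarith
    field_simp

theorem exists_muFun_sub_eq_le {β : ℝ} (hβ : 0 ≤ β) (s t : ℝ) : ∃ c, 0 ≤ c ∧ c ≤ β / 2 ∧
    2 * (muFun β s - muFun β t) = -c * (s - t) := by
  obtain ⟨y, -, hy⟩ := exists_muFun_sub_eq β s t
  refine ⟨2 * (β * Real.exp (β * y) / (1 + Real.exp (β * y)) ^ 2), by positivity, ?_, ?_⟩
  · rw [← mul_div_assoc, div_le_iff₀ (by positivity)]
    nlinarith [mul_nonneg hβ (sq_nonneg (Real.exp (β * y) - 1))]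
  · rw [hy]; ring

theorem exists_muFun_sub_eq_le_exp {β ρ s t : ℝ} (hβ : 0 ≤ β) (hs : ρ ≤ s) (ht : ρ ≤ t) :
    ∃ c, 0 ≤ c ∧ c ≤ 2 * β * Real.exp (-(β * ρ)) ∧
      2 * (muFun β s - muFun β t) = -c * (s - t) := by
  obtain ⟨y, hρ, hy⟩ := exists_muFun_sub_eq β s t
  refine ⟨2 * (β * Real.exp (β * y) / (1 + Real.exp (β * y)) ^ 2), by positivity, ?_, ?_⟩
  · have h1 : Real.exp (-(β * y)) ≤ Real.exp (-(β * ρ)) := by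
      gcongr
      exact (le_min hs ht).trans hρ
    refine le_trans ?_ (mul_le_mul_of_nonneg_left h1 (by positivity))
    have h2 := Real.exp_pos (β * y)
    rw [Real.exp_neg, ← mul_div_assoc, div_le_iff₀ (by positivity)]
    calc 2 * (β * Real.exp (β * y))
        = 2 * β * (Real.exp (β * y))⁻¹ * Real.exp (β * y) ^ 2 := by field_simp
      _ ≤ 2 * β * (Real.exp (β * y))⁻¹ * (1 + Real.exp (β * y)) ^ 2 := by
        gcongr
        linarith
  · rw [hy]; ring

/-- Conditional mean of the increments of the walks when the normalized displacement is `x`. -/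
noncomputable def meanIncrement (β : ℝ) (x : Fin 3 → ℝ) (i : Fin 3) : ℝ :=
  2 * muFun β (∑ j ∈ Finset.univ.erase i, x j) - 1

theorem continuous_meanIncrement (β : ℝ) : Continuous (meanIncrement β) := by
  refine continuous_pi fun i => ?_
  have := (continuous_muFun β).comp
    (continuous_finsetSum (Finset.univ.erase i) fun j _ => continuous_apply (A := fun _ => ℝ) j)
  exact (continuous_const.mul this).sub continuous_const

theorem sum_erase_fin_three (x : Fin 3 → ℝ) :
    ∑ j ∈ Finset.univ.erase 0, x j = x 1 + x 2 ∧ ∑ j ∈ Finset.univ.erase 1, x j = x 0 + x 2 ∧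
      ∑ j ∈ Finset.univ.erase 2, x j = x 0 + x 1 := by
  refine ⟨?_, ?_, ?_⟩ <;>
  · rw [← add_right_inj, Finset.add_sum_erase _ _ (Finset.mem_univ _), Fin.sum_univ_three]
    ring

/-- The normalized displacements of the walks. -/
noncomputable def normDisp {Ω : Type*} (S : ℕ → Ω → Fin 3 → ℤ) (n : ℕ) (ω : Ω) (i : Fin 3) : ℝ :=
  ((S n ω i - S 0 ω i : ℤ) : ℝ) / n

/-- The increments of the walks. -/
noncomputable def increment {Ω : Type*} (S : ℕ → Ω → Fin 3 → ℤ) (n : ℕ) (ω : Ω) (i : Fin 3) : ℝ :=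
  ((S (n + 1) ω i - S n ω i : ℤ) : ℝ)

section Walks

variable {Ω : Type*} {mΩ : MeasurableSpace Ω} {ℙ : Measure Ω} {𝒜 : Filtration ℕ mΩ}
  {S : ℕ → Ω → Fin 3 → ℤ} {β : ℝ}

theorem Setup.upProb_ae_eq (h : Setup β mΩ ℙ 𝒜 S) : ∀ n, 1 ≤ n → ∀ i,
    upProb mΩ ℙ 𝒜 S n i =ᵐ[ℙ] fun ω => muFun β (∑ j ∈ Finset.univ.erase i, normDisp S n ω j) :=
  h.2.2.2.2.1

theorem Setup.abs_sub_le (h : Setup β mΩ ℙ 𝒜 S) (n : ℕ) (ω : Ω) (i : Fin 3) :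
    |S n ω i - S 0 ω i| ≤ n := by
  induction n with
  | zero => simp
  | succ n ih =>
    rw [abs_le] at ih ⊢
    push_cast
    rcases h.2.1 n ω i with h | h <;> constructor <;> linarith

theorem Setup.measurable_apply (h : Setup β mΩ ℙ 𝒜 S) (n : ℕ) (i : Fin 3) :
    Measurable fun ω => S n ω i :=
  (measurable_pi_apply i).comp (h.1 n)

theorem Setup.aestronglyMeasurable_normDisp (h : Setup β mΩ ℙ 𝒜 S) (hβ : 0 < β) {n : ℕ}
    (hn : 1 ≤ n) : AEStronglyMeasurable[𝒜 n] (normDisp S n) ℙ := by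
  let u : Fin 3 → Ω → ℝ := fun i ω => Real.log (1 / upProb mΩ ℙ 𝒜 S n i ω - 1) / β
  have hlog : Measurable fun t : ℝ => Real.log (1 / t - 1) / β := by fun_prop
  have hu : ∀ i, Measurable[𝒜 n] (u i) := fun i =>
    hlog.comp (stronglyMeasurable_condExp (m := 𝒜 n)).measurable
  refine ⟨fun ω i => (∑ j, u j ω) / 2 - u i ω, ?_, ?_⟩
  · have hlin : Measurable fun (y : Fin 3 → ℝ) (i : Fin 3) => (∑ j, y j) / 2 - y i := by fun_prop
    exact (hlin.comp (@measurable_pi_lambda Ω (Fin 3) _ (𝒜 n) _ _ hu)).stronglyMeasurable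
  · filter_upwards [h.upProb_ae_eq n hn 0, h.upProb_ae_eq n hn 1, h.upProb_ae_eq n hn 2]
      with ω h0 h1 h2
    obtain ⟨e0, e1, e2⟩ := sum_erase_fin_three (normDisp S n ω)
    have k0 : u 0 ω = normDisp S n ω 1 + normDisp S n ω 2 := by
      simp only [u, h0, log_one_div_muFun_sub_one hβ, e0]
    have k1 : u 1 ω = normDisp S n ω 0 + normDisp S n ω 2 := by
      simp only [u, h1, log_one_div_muFun_sub_one hβ, e1]
    have k2 : u 2 ω = normDisp S n ω 0 + normDisp S n ω 1 := by
      simp only [u, h2, log_one_div_muFun_sub_one hβ, e2]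
    ext i
    simp only [Fin.sum_univ_three, k0, k1, k2]
    fin_cases i <;> simp only [Fin.zero_eta, Fin.mk_one, Fin.reduceFinMk, k0, k1, k2] <;> ring

theorem Setup.ae_upProb_eq (h : Setup β mΩ ℙ 𝒜 S) : ∀ᵐ ω ∂ℙ, ∀ n, 1 ≤ n → ∀ i,
    upProb mΩ ℙ 𝒜 S n i ω = muFun β (∑ j ∈ Finset.univ.erase i, normDisp S n ω j) := by
  rw [ae_all_iff]
  intro n
  by_cases hn : 1 ≤ n
  · filter_upwards [ae_all_iff.2 (h.upProb_ae_eq n hn)] with ω hω _ using hω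
  · exact Eventually.of_forall fun ω hn' => absurd hn' hn

variable [IsProbabilityMeasure ℙ]

theorem Setup.isStochasticApproximation (h : Setup β mΩ ℙ 𝒜 S) (hβ : 0 < β) :
    IsStochasticApproximation ℙ 𝒜 (meanIncrement β) (normDisp S) (increment S) where
  state_mem n hn ω := by
    have hn' : (0 : ℝ) < n := by exact_mod_cast hn
    have key : ∀ i, |normDisp S n ω i| ≤ 1 := fun i => by
      rw [normDisp, abs_div, abs_of_pos hn', div_le_one hn']
      exact_mod_cast h.abs_sub_le n ω i
    exact ⟨fun i => (abs_le.1 (key i)).1, fun i => (abs_le.1 (key i)).2⟩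
  innovation_mem n ω := by
    constructor <;> intro i <;> simp only [increment, Pi.neg_apply, Pi.one_apply] <;>
      rcases h.2.1 n ω i with h | h <;> rw [h] <;> norm_num
  step n hn ω := by
    have hn' : (0 : ℝ) < n := by exact_mod_cast hn
    ext i
    simp only [normDisp, increment, Pi.add_apply, Pi.smul_apply, Pi.sub_apply, smul_eq_mul]
    push_cast
    field_simp
    ring
  state_meas n hn := h.aestronglyMeasurable_normDisp hβ hn
  innovation_meas n := measurable_pi_lambda _ fun i =>
    (measurable_from_top (f := fun z : ℤ => (z : ℝ))).comp
      ((h.measurable_apply (n + 1) i).sub (h.measurable_apply n i))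
  condExp n hn i := by
    let up : Ω → ℝ := fun ω => if S (n + 1) ω i = S n ω i + 1 then 1 else 0
    have hup : Integrable up ℙ := by
      refine .of_bound (Measurable.aestronglyMeasurable ?_) 1 (Eventually.of_forall fun ω => ?_)
      · exact Measurable.ite (measurableSet_eq_fun (h.measurable_apply (n + 1) i)
          ((h.measurable_apply n i).add_const 1)) measurable_const measurable_const
      · simp only [up]; split_ifs <;> norm_num
    have heq : (fun ω => increment S n ω i) = (2 : ℝ) • up - fun _ => 1 := by
      ext ω
      simp only [increment, up, Pi.sub_apply, Pi.smul_apply, smul_eq_mul]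
      rcases h.2.1 n ω i with h | h
      · rw [if_pos (by linarith), h]; norm_num
      · rw [if_neg (by linarith), h]; norm_num
    rw [heq]
    filter_upwards [condExp_sub (hup.smul (2 : ℝ)) (integrable_const 1) (𝒜 n),
      condExp_smul (2 : ℝ) up (𝒜 n) (μ := ℙ), h.upProb_ae_eq n hn i] with ω h1 h2 h3
    rw [h1, Pi.sub_apply, h2, condExp_const (𝒜.le n)]
    simp only [Pi.smul_apply, smul_eq_mul, meanIncrement]
    rw [← h3]
    rfl

end Walks

/-- A quadratic function with the correct drift is a Lyapunov function. -/
theorem IsLyapunov.of_quadratic {ι : Type*} [Fintype ι] {F D : (ι → ℝ) → ι → ℝ}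
    {V R : (ι → ℝ) → ℝ} {δ M C r : ℝ} (hV : Continuous V) (hD : Continuous D) (hV0 : ∀ x, 0 ≤ V x)
    (hexp : ∀ x d t, V (x + t • d) = V x + t * ∑ i, D x i * d i + R d * t ^ 2)
    (hR0 : ∀ d, 0 ≤ R d) (hR : ∀ d, (∀ i, |d i| ≤ 2) → R d ≤ C)
    (hM : ∀ x ∈ Set.Icc (-1 : ι → ℝ) 1, ∀ i, |D x i| ≤ M)
    (hdrift : ∀ x ∈ Set.Icc (-1 : ι → ℝ) 1, V x < r → ∑ i, D x i * (F x i - x i) ≤ -δ * V x) :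
    IsLyapunov F V D δ (Fintype.card ι * (M * 2) + C) r := by
  have hd : ∀ x ∈ Set.Icc (-1 : ι → ℝ) 1, ∀ w ∈ Set.Icc (-1 : ι → ℝ) 1, ∀ i, |(w - x) i| ≤ 2 := by
    intro x hx w hw i
    have h1 := hx.1 i
    have h2 := hx.2 i
    have h3 := hw.1 i
    have h4 := hw.2 i
    simp only [Pi.neg_apply, Pi.one_apply] at h1 h2 h3 h4
    rw [Pi.sub_apply, abs_le]
    constructor <;> linarith
  have hsum : ∀ x ∈ Set.Icc (-1 : ι → ℝ) 1, ∀ w ∈ Set.Icc (-1 : ι → ℝ) 1,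
      |∑ i, D x i * (w - x) i| ≤ Fintype.card ι * (M * 2) := by
    intro x hx w hw
    calc |∑ i, D x i * (w - x) i| ≤ ∑ i, |D x i * (w - x) i| := Finset.abs_sum_le_sum_abs _ _
      _ ≤ ∑ _i : ι, M * 2 := Finset.sum_le_sum fun i _ => by
        rw [abs_mul]
        exact mul_le_mul (hM x hx i) (hd x hx w hw i) (abs_nonneg _)
          ((abs_nonneg _).trans (hM x hx i))
      _ = Fintype.card ι * (M * 2) := by simp
  refine ⟨hV, hD, hV0, fun x hx w hw t ht => ?_, fun x hx w hw t ht => ?_, hdrift⟩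
  · rw [hexp]
    have h1 := (abs_nonneg _).trans (hsum x hx w hw)
    have h2 : R (w - x) * t ^ 2 ≤ (Fintype.card ι * (M * 2) + C) * t ^ 2 := by
      have := hR _ (hd x hx w hw)
      gcongr
      linarith
    simpa only [Pi.sub_apply, add_le_add_iff_left] using h2
  · have h0 := hR0 (w - x)
    have h1 := hR _ (hd x hx w hw)
    have h2 : t ^ 2 ≤ t := by nlinarith [ht.1, ht.2]
    rw [hexp, add_assoc, add_sub_cancel_left, add_mul]
    refine (abs_add_le _ _).trans (add_le_add ?_ ?_)
    · rw [abs_mul, abs_of_nonneg ht.1, mul_comm]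
      exact mul_le_mul_of_nonneg_right (hsum x hx w hw) ht.1
    · rw [abs_of_nonneg (by positivity)]
      exact mul_le_mul h1 h2 (sq_nonneg t) (h0.trans h1)

/-- For `β < 2`, the function `∑ xᵢ² + (∑ xᵢ)²` is a global Lyapunov function. -/
theorem isLyapunov_of_lt_two {β : ℝ} (hβ : 0 ≤ β) : ∃ C,
    IsLyapunov (meanIncrement β) (fun x => x 0 ^ 2 + x 1 ^ 2 + x 2 ^ 2 + (x 0 + x 1 + x 2) ^ 2)
      (fun x i => 2 * x i + 2 * (x 0 + x 1 + x 2)) (2 - β) C 13 := by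
  refine ⟨_, IsLyapunov.of_quadratic (M := 8) (C := 48)
    (R := fun d => d 0 ^ 2 + d 1 ^ 2 + d 2 ^ 2 + (d 0 + d 1 + d 2) ^ 2) (by fun_prop) (by fun_prop)
    (fun x => by positivity) ?_ (fun d => by positivity) ?_ ?_ ?_⟩
  · intro x d t
    simp only [Fin.sum_univ_three, Pi.add_apply, Pi.smul_apply, smul_eq_mul]
    ring
  · intro d hd
    have e0 := sq_le_sq' (abs_le.1 (hd 0)).1 (abs_le.1 (hd 0)).2
    have e1 := sq_le_sq' (abs_le.1 (hd 1)).1 (abs_le.1 (hd 1)).2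
    have e2 := sq_le_sq' (abs_le.1 (hd 2)).1 (abs_le.1 (hd 2)).2
    nlinarith [sq_nonneg (d 0 - d 1), sq_nonneg (d 0 - d 2), sq_nonneg (d 1 - d 2)]
  · intro x hx i
    have h1 : ∀ j, -1 ≤ x j := hx.1
    have h2 : ∀ j, x j ≤ 1 := hx.2
    rw [abs_le]
    constructor <;> linarith [h1 0, h1 1, h1 2, h1 i, h2 0, h2 1, h2 2, h2 i]
  · intro x _ _
    obtain ⟨e0, e1, e2⟩ := sum_erase_fin_three x
    have key : ∀ u, ∃ c, 0 ≤ c ∧ c ≤ β / 2 ∧ 2 * muFun β u - 1 = -c * u := fun u => by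
      obtain ⟨c, h0, h1, h2⟩ := exists_muFun_sub_eq_le hβ u 0
      refine ⟨c, h0, h1, ?_⟩
      rw [muFun_zero] at h2
      linarith
    obtain ⟨a, ha0, ha1, ha⟩ := key (x 1 + x 2)
    obtain ⟨b, hb0, hb1, hb⟩ := key (x 0 + x 2)
    obtain ⟨c, hc0, hc1, hc⟩ := key (x 0 + x 1)
    simp only [Fin.sum_univ_three, meanIncrement, e0, e1, e2, ha, hb, hc]
    nlinarith [mul_le_mul_of_nonneg_right ha1 (sq_nonneg (x 0)),
      mul_le_mul_of_nonneg_right hb1 (sq_nonneg (x 1)),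
      mul_le_mul_of_nonneg_right hc1 (sq_nonneg (x 2)),
      mul_nonneg ha0 (sq_nonneg (x 0 + x 1 + x 2)), mul_nonneg hb0 (sq_nonneg (x 0 + x 1 + x 2)),
      mul_nonneg hc0 (sq_nonneg (x 0 + x 1 + x 2)), mul_nonneg hβ (sq_nonneg (x 0 + x 1 + x 2))]

theorem neg_mul_sq_add_sq_le {k K : ℝ} (u v : ℝ) (hk : 0 ≤ k) (hK : k ≤ K) :
    -(K * (u ^ 2 + v ^ 2)) ≤ 2 * (k * (u * v)) := by
  have h1 := mul_nonneg hk (sq_nonneg (u + v))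
  have h2 := mul_le_mul_of_nonneg_right hK (add_nonneg (sq_nonneg u) (sq_nonneg v))
  linarith

/-- For large `β`, the point `(a, -a, 0)` with `a = 1 - 2 * muFun β a` is a stable equilibrium. -/
theorem isLyapunov_equilibrium {β a : ℝ} (hβ : 1 ≤ β)
    (hε : β * (2 * β * Real.exp (-(β * (1 / 4)))) ≤ 1 / 8)
    (ha : 1 / 2 ≤ a) (ha1 : a ≤ 1) (hfix : 2 * muFun β a = 1 - a) : ∃ C,
    IsLyapunov (meanIncrement β) (fun x => β ^ 2 * ((x 0 - a) ^ 2 + (x 1 + a) ^ 2) + x 2 ^ 2)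
      (fun x => ![2 * β ^ 2 * (x 0 - a), 2 * β ^ 2 * (x 1 + a), 2 * x 2]) (1 / 2) C (1 / 64) := by
  have hβ0 : 0 ≤ β := by linarith
  have hβ2 : 1 ≤ β ^ 2 := one_le_pow₀ hβ
  refine ⟨_, IsLyapunov.of_quadratic (M := 4 * β ^ 2) (C := 8 * β ^ 2 + 4)
    (R := fun d => β ^ 2 * (d 0 ^ 2 + d 1 ^ 2) + d 2 ^ 2) (by fun_prop) (by fun_prop)
    (fun x => by positivity) ?_ (fun d => by positivity) ?_ ?_ ?_⟩
  · intro x d t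
    simp only [Fin.sum_univ_three, Pi.add_apply, Pi.smul_apply, smul_eq_mul, Matrix.cons_val]
    ring
  · intro d hd
    have e0 := sq_le_sq' (abs_le.1 (hd 0)).1 (abs_le.1 (hd 0)).2
    have e1 := sq_le_sq' (abs_le.1 (hd 1)).1 (abs_le.1 (hd 1)).2
    have e2 := sq_le_sq' (abs_le.1 (hd 2)).1 (abs_le.1 (hd 2)).2
    have := mul_le_mul_of_nonneg_left (add_le_add e0 e1) (sq_nonneg β)
    linarith
  · intro x hx i
    have h1 : ∀ j, -1 ≤ x j := hx.1
    have h2 : ∀ j, x j ≤ 1 := hx.2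
    have h3 := h1 0
    have h4 := h2 0
    have h5 := h1 1
    have h6 := h2 1
    have h7 := h1 2
    have h8 := h2 2
    rw [abs_le]
    fin_cases i <;> simp only [Fin.zero_eta, Fin.mk_one, Fin.reduceFinMk, Matrix.cons_val] <;>
      constructor <;> nlinarith
  · intro x _ hx
    obtain ⟨e0, e1, e2⟩ := sum_erase_fin_three x
    obtain ⟨p, hp⟩ : ∃ p, p = x 0 - a := ⟨_, rfl⟩
    obtain ⟨q, hq⟩ : ∃ q, q = x 1 + a := ⟨_, rfl⟩
    obtain ⟨z, hz⟩ : ∃ z, z = x 2 := ⟨_, rfl⟩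
    have hx0 : x 0 = a + p := by linarith
    have hx1 : x 1 = -a + q := by linarith
    rw [← hp, ← hq, ← hz] at hx
    have hp2 := mul_le_mul_of_nonneg_right hβ2 (sq_nonneg p)
    have hq2 := mul_le_mul_of_nonneg_right hβ2 (sq_nonneg q)
    have hpb : |p| ≤ 1 / 8 := abs_le_of_sq_le_sq (by nlinarith) (by norm_num)
    have hqb : |q| ≤ 1 / 8 := abs_le_of_sq_le_sq (by nlinarith) (by norm_num)
    have hzb : |z| ≤ 1 / 8 := abs_le_of_sq_le_sq (by nlinarith) (by norm_num)
    rw [abs_le] at hpb hqb hzb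
    obtain ⟨c, hc0, hc1, hc⟩ := exists_muFun_sub_eq_le_exp (ρ := 1 / 4) (s := a - q - z) (t := a)
      hβ0 (by linarith) (by linarith)
    obtain ⟨d, hd0, hd1, hd⟩ := exists_muFun_sub_eq_le_exp (ρ := 1 / 4) (s := a + p + z) (t := a)
      hβ0 (by linarith) (by linarith)
    obtain ⟨e, he0, he1, he⟩ := exists_muFun_sub_eq_le hβ0 (p + q) 0
    have hm0 : 2 * muFun β (x 1 + x 2) - 1 = a - c * (q + z) := by
      rw [show x 1 + x 2 = -(a - q - z) by linarith, muFun_neg]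
      linarith
    have hm1 : 2 * muFun β (x 0 + x 2) - 1 = -a - d * (p + z) := by
      rw [show x 0 + x 2 = a + p + z by linarith]
      linarith
    have hm2 : 2 * muFun β (x 0 + x 1) - 1 = -e * (p + q) := by
      rw [show x 0 + x 1 = p + q by linarith]
      rw [muFun_zero] at he
      linarith
    simp only [Fin.sum_univ_three, meanIncrement, e0, e1, e2, hm0, hm1, hm2, Matrix.cons_val]
    rw [← hp, ← hq, ← hz, hx0, hx1]
    have hc2 : β * c ≤ 1 / 8 := (mul_le_mul_of_nonneg_left hc1 hβ0).trans hε
    have hd2 : β * d ≤ 1 / 8 := (mul_le_mul_of_nonneg_left hd1 hβ0).trans hε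
    have hc3 : c ≤ 1 / 8 := (le_mul_of_one_le_left hc0 hβ).trans hc2
    have hd3 : d ≤ 1 / 8 := (le_mul_of_one_le_left hd0 hβ).trans hd2
    obtain ⟨f, rfl⟩ : ∃ f, e = β * f := ⟨e / β, by field_simp⟩
    have hf0 : 0 ≤ f := nonneg_of_mul_nonneg_right he0 (by linarith)
    have hf1 : f ≤ 1 / 2 := le_of_mul_le_mul_left (by linarith) (by linarith : 0 < β)
    linarith [neg_mul_sq_add_sq_le (β * p) (β * q) hc0 hc3,
      neg_mul_sq_add_sq_le (β * p) (β * q) hd0 hd3,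
      neg_mul_sq_add_sq_le (β * p) z (mul_nonneg hβ0 hc0) hc2,
      neg_mul_sq_add_sq_le (β * q) z (mul_nonneg hβ0 hd0) hd2,
      neg_mul_sq_add_sq_le (β * p) z hf0 hf1, neg_mul_sq_add_sq_le (β * q) z hf0 hf1,
      sq_nonneg (β * p), sq_nonneg (β * q), sq_nonneg z]

theorem tendsto_zero_of_sq_le {f V : ℕ → ℝ} (hV : Tendsto V atTop (nhds 0))
    (h : ∀ n, f n ^ 2 ≤ V n) : Tendsto f atTop (nhds 0) := by
  have h1 : Tendsto (fun n => f n ^ 2) atTop (nhds 0) :=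
    squeeze_zero (fun n => sq_nonneg _) h hV
  have h2 := h1.sqrt
  simp only [Real.sqrt_sq_eq_abs, Real.sqrt_zero] at h2
  exact (tendsto_zero_iff_abs_tendsto_zero f).2 h2

theorem tendsto_atTop_of_tendsto_div_pos {z : ℕ → ℤ} {b : ℤ} {a : ℝ} (ha : 0 < a)
    (h : Tendsto (fun n => ((z n - b : ℤ) : ℝ) / n) atTop (nhds a)) : Tendsto z atTop atTop := by
  have h1 : Tendsto (fun n => ((z n - b : ℤ) : ℝ)) atTop atTop := by
    refine (h.pos_mul_atTop ha tendsto_natCast_atTop_atTop).congr' ?_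
    filter_upwards [eventually_ge_atTop 1] with n hn
    have : (n : ℝ) ≠ 0 := by positivity
    field_simp
  simpa using tendsto_atTop_add_const_right _ b (tendsto_intCast_atTop_iff.1 h1)

theorem measure_inter_pos_of_condExp_pos {Ω : Type*} {m mΩ : MeasurableSpace Ω} {ℙ : Measure Ω}
    [IsFiniteMeasure ℙ] (hm : m ≤ mΩ) {A B : Set Ω} (hA : MeasurableSet[m] A)
    (hB : MeasurableSet B) (hA0 : 0 < ℙ A)
    (hpos : ∀ᵐ ω ∂ℙ, 0 < (ℙ[B.indicator (fun _ => (1 : ℝ)) | m]) ω) : 0 < ℙ (A ∩ B) := by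
  have h1 := setIntegral_condExp hm ((integrable_const (1 : ℝ)).indicator hB (μ := ℙ)) hA
  rw [setIntegral_indicator hB, setIntegral_const, smul_eq_mul, mul_one] at h1
  have h2 : 0 < ∫ ω in A, (ℙ[B.indicator (fun _ => (1 : ℝ)) | m]) ω ∂ℙ := by
    rw [setIntegral_pos_iff_support_of_nonneg_ae
      (ae_restrict_of_ae (hpos.mono fun ω h => h.le)) integrable_condExp.integrableOn]
    refine hA0.trans_le (measure_mono_ae ?_)
    filter_upwards [hpos] with ω hω hωA using ⟨hω.ne', hωA⟩
  rw [h1] at h2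
  exact (ENNReal.toReal_pos_iff.1 h2).1

theorem muFun_le_exp (β y : ℝ) : muFun β y ≤ Real.exp (-(β * y)) := by
  rw [Real.exp_neg, ← one_div, muFun]
  gcongr
  linarith

theorem pow_three_mul_exp_neg_le {β : ℝ} (hβ : 0 ≤ β) :
    β ^ 3 * Real.exp (-(β * (1 / 4))) ≤ 384 := by
  have h1 := Real.pow_div_factorial_le_exp (β * (1 / 4)) (by positivity) 3
  rw [Real.exp_neg, ← div_eq_mul_inv, div_le_iff₀ (Real.exp_pos _)]
  norm_num [Nat.factorial] at h1
  linarith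

theorem exists_equilibrium {β : ℝ} (hβ : 10000 ≤ β) : ∃ a, 1 / 2 ≤ a ∧ a ≤ 1 ∧
    2 * muFun β a = 1 - a ∧ β * (1 - a) ≤ 1 / 64 := by
  have h3 := pow_three_mul_exp_neg_le (β := β) (by linarith)
  have hexp : β * (2 * muFun β (1 / 2)) ≤ 1 / 64 := by
    have h1 : muFun β (1 / 2) ≤ Real.exp (-(β * (1 / 4))) :=
      (muFun_le_exp _ _).trans (Real.exp_le_exp.2 (by linarith))
    have h2 : 10000 ^ 2 * (β * Real.exp (-(β * (1 / 4)))) ≤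
        β ^ 2 * (β * Real.exp (-(β * (1 / 4)))) := by gcongr
    have h4 := mul_le_mul_of_nonneg_left h1 (by linarith : 0 ≤ β)
    linarith
  have hhalf : 2 * muFun β (1 / 2) ≤ 1 / 64 := by
    have := muFun_pos β (1 / 2)
    nlinarith
  obtain ⟨a, ha, hfix⟩ := intermediate_value_Icc (by norm_num : (1 / 2 : ℝ) ≤ 1)
    (f := fun t => 2 * muFun β t + t)
    (((continuous_muFun β).const_mul 2).add continuous_id).continuousOn
    (show (1 : ℝ) ∈ _ from ⟨by linarith, by linarith [muFun_pos β 1]⟩)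
  have hfix : 2 * muFun β a = 1 - a := by linarith
  refine ⟨a, ha.1, ha.2, hfix, ?_⟩
  obtain ⟨c, hc0, -, hc⟩ := exists_muFun_sub_eq_le (by linarith : 0 ≤ β) a (1 / 2)
  have hle : 2 * muFun β a ≤ 2 * muFun β (1 / 2) := by
    have := mul_nonneg hc0 (sub_nonneg.2 ha.1)
    linarith
  rw [← hfix]
  exact (mul_le_mul_of_nonneg_left hle (by linarith)).trans hexp

/-- A sequence of steps leading the first walk up and the second one down while the third
one oscillates. -/
def forcedStep (k : ℕ) : Fin 3 → ℤ := ![1, -1, (-1) ^ k]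

theorem forcedStep_eq (k : ℕ) (i : Fin 3) : forcedStep k i = 1 ∨ forcedStep k i = -1 := by
  fin_cases i
  · exact Or.inl rfl
  · exact Or.inr rfl
  · exact neg_one_pow_eq_or ℤ k

/-- The event that the walks follow `forcedStep` from time `1` to time `N`. -/
def forcedPath {Ω : Type*} (S : ℕ → Ω → Fin 3 → ℤ) (N : ℕ) : Set Ω :=
  {ω | ∀ k, 1 ≤ k → k < N → ∀ i, S (k + 1) ω i = S k ω i + forcedStep k i}

theorem measurableSet_forcedPath {Ω : Type*} [MeasurableSpace Ω] {S : ℕ → Ω → Fin 3 → ℤ} {N : ℕ}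
    (hS : ∀ k, 1 ≤ k → k ≤ N → ∀ i, Measurable fun ω => S k ω i) :
    MeasurableSet (forcedPath S N) := by
  simp only [forcedPath, Set.ofPred_forall]
  refine .iInter fun k => .iInter fun hk => .iInter fun hkN => .iInter fun i => ?_
  exact measurableSet_eq_fun (hS (k + 1) (by omega) hkN i) ((hS k hk hkN.le i).add_const _)

theorem forcedPath_succ {Ω : Type*} (S : ℕ → Ω → Fin 3 → ℤ) {N : ℕ} (hN : 1 ≤ N) :
    forcedPath S (N + 1) =
      forcedPath S N ∩ {ω | ∀ i, S (N + 1) ω i = S N ω i + forcedStep N i} := by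
  ext ω
  constructor
  · exact fun h => ⟨fun k hk hkN => h k hk (by omega), h N hN (by omega)⟩
  · rintro ⟨h1, h2⟩ k hk hkN
    rcases Nat.lt_succ_iff_lt_or_eq.1 hkN with hk' | rfl
    · exact h1 k hk hk'
    · exact h2

theorem displacement_of_mem_forcedPath {Ω : Type*} {S : ℕ → Ω → Fin 3 → ℤ} {ω : Ω} {N : ℕ}
    (hN : 1 ≤ N) (h : ω ∈ forcedPath S N) :
    S N ω 0 = S 1 ω 0 + (N - 1) ∧ S N ω 1 = S 1 ω 1 - (N - 1) ∧
      2 * (S N ω 2 - S 1 ω 2) + 1 = -(-1) ^ N := by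
  induction N, hN using Nat.le_induction with
  | base => simp
  | succ N hN ih =>
    rw [forcedPath_succ S hN] at h
    obtain ⟨h0, h1, h2⟩ := ih h.1
    have k0 : S (N + 1) ω 0 = S N ω 0 + 1 := h.2 0
    have k1 : S (N + 1) ω 1 = S N ω 1 + -1 := h.2 1
    have k2 : S (N + 1) ω 2 = S N ω 2 + (-1) ^ N := h.2 2
    rw [pow_succ]
    push_cast
    refine ⟨by linarith, by linarith, by linarith⟩

section Walks

variable {Ω : Type*} {mΩ : MeasurableSpace Ω} {ℙ : Measure Ω} {𝒜 : Filtration ℕ mΩ}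
  {S : ℕ → Ω → Fin 3 → ℤ} {β : ℝ}

theorem Setup.measurable_apply_of_le (h : Setup β mΩ ℙ 𝒜 S) {k N : ℕ} (hk : 1 ≤ k) (hkN : k ≤ N)
    (i : Fin 3) : Measurable[𝒜 N] fun ω => S k ω i := by
  intro t _
  rw [h.2.2.1 N]
  exact le_iSup₂ (f := fun k (_ : k ∈ Finset.Icc 1 N) => MeasurableSpace.comap (S k) ⊤) k
    (Finset.mem_Icc.2 ⟨hk, hkN⟩) _ ⟨{v | v i ∈ t}, trivial, rfl⟩

theorem Setup.measurableSet_forcedPath (h : Setup β mΩ ℙ 𝒜 S) (N : ℕ) :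
    MeasurableSet[𝒜 N] (forcedPath S N) :=
  @_root_.measurableSet_forcedPath Ω (𝒜 N) S N fun _ hk hkN i => h.measurable_apply_of_le hk hkN i

theorem Setup.measure_forcedPath_pos [IsProbabilityMeasure ℙ] (h : Setup β mΩ ℙ 𝒜 S) {N : ℕ}
    (hN : 1 ≤ N) : 0 < ℙ (forcedPath S N) := by
  induction N, hN using Nat.le_induction with
  | base =>
    have : forcedPath S 1 = Set.univ := Set.eq_univ_of_forall fun ω k hk hk1 => by omega
    simp [this]
  | succ N hN ih =>
    rw [forcedPath_succ S hN]
    have hB : MeasurableSet {ω | ∀ i, S (N + 1) ω i = S N ω i + forcedStep N i} := by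
      rw [Set.ofPred_forall]
      exact .iInter fun i => measurableSet_eq_fun (h.measurable_apply _ i)
        ((h.measurable_apply _ i).add_const _)
    refine measure_inter_pos_of_condExp_pos (𝒜.le N) (h.measurableSet_forcedPath N) hB ih ?_
    have heq : Set.indicator {ω | ∀ i, S (N + 1) ω i = S N ω i + forcedStep N i}
        (fun _ => (1 : ℝ)) =
        fun ω => if (∀ i, S (N + 1) ω i = S N ω i + forcedStep N i) then (1 : ℝ) else 0 := by
      ext ω
      by_cases hω : ∀ i, S (N + 1) ω i = S N ω i + forcedStep N i
      · rw [Set.indicator_of_mem (by exact hω), if_pos hω]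
      · rw [Set.indicator_of_notMem (by exact hω), if_neg hω]
    rw [heq]
    filter_upwards [h.2.2.2.2.2 N hN _ (forcedStep_eq N)] with ω hω
    rw [hω]
    refine Finset.prod_pos fun i _ => ?_
    split_ifs
    · exact muFun_pos _ _
    · exact sub_pos.2 (muFun_lt_one _ _)

theorem Setup.normDisp_of_mem_forcedPath (h : Setup β mΩ ℙ 𝒜 S) {ω : Ω} {N : ℕ}
    (hN : 1 ≤ N) (hω : ω ∈ forcedPath S N) :
    |normDisp S N ω 0 - 1| ≤ 2 / N ∧ |normDisp S N ω 1 + 1| ≤ 2 / N ∧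
      |normDisp S N ω 2| ≤ 2 / N := by
  obtain ⟨h0, h1, h2⟩ := displacement_of_mem_forcedPath hN hω
  have hN' : (0 : ℝ) < N := by exact_mod_cast hN
  have hfirst : ∀ i, |S 1 ω i - S 0 ω i| ≤ 1 := fun i => by simpa using h.abs_sub_le 1 ω i
  have key : ∀ z : ℤ, |z| ≤ 2 → |(z : ℝ) / N| ≤ 2 / N := fun z hz => by
    rw [abs_div, abs_of_pos hN']
    gcongr
    exact_mod_cast hz
  have hf0 := abs_le.1 (hfirst 0)
  have hf1 := abs_le.1 (hfirst 1)
  have hf2 := abs_le.1 (hfirst 2)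
  refine ⟨?_, ?_, ?_⟩
  · convert key (S N ω 0 - S 0 ω 0 - N) (abs_le.2 ⟨by linarith, by linarith⟩) using 2
    rw [normDisp]
    push_cast
    field_simp
  · convert key (S N ω 1 - S 0 ω 1 + N) (abs_le.2 ⟨by linarith, by linarith⟩) using 2
    rw [normDisp]
    push_cast
    field_simp
  · refine key _ (abs_le.2 ?_)
    rcases neg_one_pow_eq_or ℤ N with e | e <;> rw [e] at h2 <;> constructor <;> linarith

theorem tendsto_upProb_of_tendsto_zero {ω : Ω} {i : Fin 3}
    (hω : ∀ n, 1 ≤ n → ∀ i, upProb mΩ ℙ 𝒜 S n i ω =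
      muFun β (∑ j ∈ Finset.univ.erase i, normDisp S n ω j))
    (h0 : Tendsto (fun n => ∑ j ∈ Finset.univ.erase i, normDisp S n ω j) atTop (nhds 0)) :
    Tendsto (fun n => upProb mΩ ℙ 𝒜 S n i ω) atTop (nhds (1 / 2)) := by
  rw [← muFun_zero β]
  refine (((continuous_muFun β).tendsto 0).comp h0).congr' ?_
  filter_upwards [eventually_ge_atTop 1] with n hn
  exact (hω n hn i).symm

variable [IsProbabilityMeasure ℙ]

theorem Setup.tendsto_upProb_of_lt_two (h : Setup β mΩ ℙ 𝒜 S) (hβ : 0 ≤ β) (hβ2 : β < 2)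
    (i : Fin 3) :
    ∀ᵐ ω ∂ℙ, Tendsto (fun n => upProb mΩ ℙ 𝒜 S n i ω) atTop (nhds (1 / 2)) := by
  rcases hβ.eq_or_lt with rfl | hβ0
  · filter_upwards [h.ae_upProb_eq] with ω hω
    refine tendsto_const_nhds.congr' ?_
    filter_upwards [eventually_ge_atTop 1] with n hn
    rw [hω n hn i]
    norm_num [muFun]
  · obtain ⟨C, hV⟩ := isLyapunov_of_lt_two hβ
    have hx := h.isStochasticApproximation hβ0
    filter_upwards [h.ae_upProb_eq, hV.ae_tendsto_zero (by linarith) (by norm_num) hx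
      (continuous_meanIncrement β) le_rfl MeasurableSet.univ] with ω hω hVω
    have hV0 := hVω (Set.mem_univ ω) fun m => by
      have hmem := hx.state_mem (1 + m) (by omega) ω
      have hsq : ∀ i, normDisp S (1 + m) ω i ^ 2 ≤ 1 := fun i =>
        (sq_le_one_iff_abs_le_one _).2 (abs_le.2 ⟨hmem.1 i, hmem.2 i⟩)
      linarith [hsq 0, hsq 1, hsq 2,
        sq_nonneg (normDisp S (1 + m) ω 0 - normDisp S (1 + m) ω 1),
        sq_nonneg (normDisp S (1 + m) ω 0 - normDisp S (1 + m) ω 2),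
        sq_nonneg (normDisp S (1 + m) ω 1 - normDisp S (1 + m) ω 2)]
    refine tendsto_upProb_of_tendsto_zero hω ?_
    rw [← Finset.sum_const_zero (s := Finset.univ.erase i) (ι := Fin 3)]
    refine tendsto_finsetSum _ fun j _ => tendsto_zero_of_sq_le hV0 fun n => ?_
    fin_cases j <;> simp only [Fin.zero_eta, Fin.mk_one, Fin.reduceFinMk] <;>
      linarith [sq_nonneg (normDisp S n ω 0), sq_nonneg (normDisp S n ω 1),
        sq_nonneg (normDisp S n ω 2),
        sq_nonneg (normDisp S n ω 0 + normDisp S n ω 1 + normDisp S n ω 2)]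

theorem Setup.measure_diverge_pos (h : Setup β mΩ ℙ 𝒜 S) (hβ : 10000 ≤ β) :
    0 < ℙ {ω | Tendsto (fun n => S n ω 0) atTop atTop ∧ Tendsto (fun n => S n ω 1) atTop atBot ∧
      Tendsto (fun n => upProb mΩ ℙ 𝒜 S n 2 ω) atTop (nhds (1 / 2))} := by
  have hβ0 : 0 < β := by linarith
  obtain ⟨a, ha, ha1, hfix, hβa⟩ := exists_equilibrium hβ
  have hε : β * (2 * β * Real.exp (-(β * (1 / 4)))) ≤ 1 / 8 := by
    have h1 := pow_three_mul_exp_neg_le hβ0.le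
    have h2 : 10000 * (β ^ 2 * Real.exp (-(β * (1 / 4)))) ≤
        β * (β ^ 2 * Real.exp (-(β * (1 / 4)))) := by gcongr
    linarith
  obtain ⟨C, hV⟩ := isLyapunov_equilibrium (by linarith) hε ha ha1 hfix
  have hx := h.isStochasticApproximation hβ0
  obtain ⟨N, hN⟩ := exists_nat_ge (max (128 * β) (256 * C))
  have hNβ : 128 * β ≤ N := (le_max_left _ _).trans hN
  have hN0 : (0 : ℝ) < N := by linarith
  have hN1 : 1 ≤ N := by exact_mod_cast hN0
  have hNC : C / N ≤ 1 / 64 / 4 := by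
    rw [div_le_iff₀ hN0]
    linarith [(le_max_right (128 * β) (256 * C)).trans hN]
  have hN2 : β * (2 / N) ≤ 1 / 64 := by
    rw [← mul_div_assoc, div_le_iff₀ hN0]
    linarith
  have hstart : ∀ ω ∈ forcedPath S N, β ^ 2 * ((normDisp S N ω 0 - a) ^ 2 +
      (normDisp S N ω 1 + a) ^ 2) + normDisp S N ω 2 ^ 2 ≤ 1 / 64 / 4 := by
    intro ω hω
    obtain ⟨h0, h1, h2⟩ := h.normDisp_of_mem_forcedPath hN1 hω
    have hscale : ∀ y b : ℝ, |y| ≤ 2 / N → |b| ≤ 1 - a → (β * (y + b)) ^ 2 ≤ (1 / 32) ^ 2 := by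
      intro y b hy hb
      refine sq_le_sq.2 ?_
      rw [abs_mul, abs_of_pos hβ0, abs_of_pos (by norm_num : (0 : ℝ) < 1 / 32)]
      have := mul_le_mul_of_nonneg_left ((abs_add_le y b).trans (add_le_add hy hb)) hβ0.le
      linarith
    have e0 := hscale _ (1 - a) h0 (abs_of_nonneg (by linarith)).le
    have e1 := hscale _ (a - 1) h1 (by rw [abs_of_nonpos (by linarith)]; linarith)
    have e2 : normDisp S N ω 2 ^ 2 ≤ (1 / 64) ^ 2 := by
      refine sq_le_sq.2 (h2.trans ((le_mul_of_one_le_left (by positivity) (by linarith)).trans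
        (hN2.trans (le_abs_self _))))
    rw [sub_add_sub_cancel, mul_pow] at e0
    rw [add_add_sub_cancel, mul_pow] at e1
    linarith
  have hsurv := hV.measure_forall_lt_pos (by norm_num) (by norm_num) hx
    (continuous_meanIncrement β) hN1 hNC (h.measurableSet_forcedPath N)
    (h.measure_forcedPath_pos hN1) hstart
  refine hsurv.trans_le (measure_mono_ae ?_)
  filter_upwards [h.ae_upProb_eq, hV.ae_tendsto_zero (by norm_num) (by norm_num) hx
    (continuous_meanIncrement β) hN1 (h.measurableSet_forcedPath N)] with ω hω hVω hmem
  have hV0 := hVω hmem.1 hmem.2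
  have hβ1 : 1 ≤ β ^ 2 := one_le_pow₀ (by linarith)
  have hp : Tendsto (fun n => normDisp S n ω 0 - a) atTop (nhds 0) :=
    tendsto_zero_of_sq_le hV0 fun n => by
      nlinarith [sq_nonneg (normDisp S n ω 0 - a), sq_nonneg (normDisp S n ω 1 + a),
        sq_nonneg (normDisp S n ω 2)]
  have hq : Tendsto (fun n => normDisp S n ω 1 + a) atTop (nhds 0) :=
    tendsto_zero_of_sq_le hV0 fun n => by
      nlinarith [sq_nonneg (normDisp S n ω 0 - a), sq_nonneg (normDisp S n ω 1 + a),
        sq_nonneg (normDisp S n ω 2)]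
  refine ⟨?_, ?_, ?_⟩
  · refine tendsto_atTop_of_tendsto_div_pos (b := S 0 ω 0) (a := a) (by linarith) ?_
    simpa [normDisp] using hp.add_const a
  · refine tendsto_neg_atTop_iff.1 ?_
    refine tendsto_atTop_of_tendsto_div_pos (b := -S 0 ω 1) (a := a) (by linarith) ?_
    have := (hq.sub_const a).neg
    simp only [add_sub_cancel_right, zero_sub, neg_neg] at this
    refine this.congr fun n => ?_
    rw [normDisp, ← neg_div]
    push_cast
    ring
  · refine tendsto_upProb_of_tendsto_zero hω ?_
    have := hp.add hq
    rw [add_zero] at this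
    refine this.congr fun n => ?_
    rw [(sum_erase_fin_three _).2.2]
    ring

end Walks

/-- (a) If `β < 2`, for each walk `i`, almost surely
`ℙ(S_{n+1}^i - S_n^i = 1 | 𝒜_n) → 1/2`.  (b) There is `β₀` such that for all `β ≥ β₀`,
with positive probability two of the walks diverge to `+∞` and `-∞` respectively while
the third one steps up with conditional probability tending to `1/2`. -/
theorem three_repelling_walks_on_Z :
    (∀ β : ℝ, 0 ≤ β → β < 2 →
      ∀ (Ω : Type) (mΩ : MeasurableSpace Ω) (ℙ : @Measure Ω mΩ),
        @IsProbabilityMeasure Ω mΩ ℙ →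
      ∀ (𝒜 : Filtration ℕ mΩ) (S : ℕ → Ω → Fin 3 → ℤ),
        Setup β mΩ ℙ 𝒜 S →
        ∀ i : Fin 3, ∀ᵐ ω ∂ℙ,
          Tendsto (fun n => upProb mΩ ℙ 𝒜 S n i ω) atTop (nhds (1 / 2))) ∧
    (∃ β₀ : ℝ, ∀ β : ℝ, β₀ ≤ β →
      ∀ (Ω : Type) (mΩ : MeasurableSpace Ω) (ℙ : @Measure Ω mΩ),
        @IsProbabilityMeasure Ω mΩ ℙ →
      ∀ (𝒜 : Filtration ℕ mΩ) (S : ℕ → Ω → Fin 3 → ℤ),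
        Setup β mΩ ℙ 𝒜 S →
        0 < ℙ {ω | ∃ i j k : Fin 3, i ≠ j ∧ j ≠ k ∧ i ≠ k ∧
          Tendsto (fun n => S n ω i) atTop atTop ∧
          Tendsto (fun n => S n ω j) atTop atBot ∧
          Tendsto (fun n => upProb mΩ ℙ 𝒜 S n k ω) atTop (nhds (1 / 2))}) := by
  refine ⟨fun β hβ hβ2 Ω mΩ ℙ _ 𝒜 S h i => h.tendsto_upProb_of_lt_two hβ hβ2 i,
    10000, fun β hβ Ω mΩ ℙ _ 𝒜 S h => ?_⟩
  refine (h.measure_diverge_pos hβ).trans_le (measure_mono ?_)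
  exact fun ω ⟨h0, h1, h2⟩ => ⟨0, 1, 2, by decide, by decide, by decide, h0, h1, h2⟩
end

section
/- Let x ∈ 𝔇, write y = π(x), and let θ = (θ_v^i) ∈ T𝔇 with Σ_{i,v} |θ_v^i| = 1. For each i ∈ [m] choose v^i ∈ [d] with θ_{v^i}^i = max_v θ_v^i. Then [ Σ_{i=1}^m max_v θ_v^i − Σ_{i=1}^m Σ_{v=1}^d θ_v^i y_v^i ]⁺ · ∏_{i=1}^m y_{v^i}^i ≥ (1/(2md)) · ( min_{i,v} y_v^i )^{m+1}, where w⁺ = max{w, 0}. -/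
def simplexD (d m : ℕ) : Set (Fin m → Fin d → ℝ) :=
  {x | ∀ i, (∀ v, 0 ≤ x i v) ∧ (∑ v, x i v) = 1}

noncomputable def piMap (d m : ℕ) (α : Fin d → Fin m → Fin m → ℝ)
    (x : Fin m → Fin d → ℝ) : Fin m → Fin d → ℝ :=
  fun i v => Real.exp (∑ j, α v i j * x j v) / ∑ u, Real.exp (∑ j, α u i j * x j u)

theorem piMap_pos {d m : ℕ} (α : Fin d → Fin m → Fin m → ℝ) (x : Fin m → Fin d → ℝ)
    (i : Fin m) (v : Fin d) : 0 < piMap d m α x i v :=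
  div_pos (Real.exp_pos _) (Finset.sum_pos (fun _ _ => Real.exp_pos _) ⟨v, Finset.mem_univ v⟩)

theorem sum_piMap {d m : ℕ} [NeZero d] (α : Fin d → Fin m → Fin m → ℝ)
    (x : Fin m → Fin d → ℝ) (i : Fin m) : ∑ v, piMap d m α x i v = 1 := by
  simp only [piMap, ← Finset.sum_div]
  exact div_self (Finset.sum_pos (fun _ _ => Real.exp_pos _) Finset.univ_nonempty).ne'

/-- If `t` sums to zero and is bounded above by `M`, then `M` exceeds the mean of `t` under a
probability vector `w` by at least half the `ℓ¹` norm of `t` times any lower bound for `w`. -/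
theorem half_mul_sum_abs_le_sub_sum_mul {ι : Type*} [Fintype ι] {t w : ι → ℝ} {M ε : ℝ}
    (ht : ∑ v, t v = 0) (hM : ∀ v, t v ≤ M) (hw : ∑ v, w v = 1)
    (hε : 0 ≤ ε) (hεw : ∀ v, ε ≤ w v) :
    ε / 2 * ∑ v, |t v| ≤ M - ∑ v, t v * w v := by
  have hM₀ : 0 ≤ M := by
    by_contra! h
    have hne : (Finset.univ : Finset ι).Nonempty :=
      Finset.nonempty_of_sum_ne_zero (hw.trans_ne one_ne_zero)
    exact (Finset.sum_neg (fun v _ => (hM v).trans_lt h) hne).ne ht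
  have hgap : M - ∑ v, t v * w v = ∑ v, (M - t v) * w v := by
    simp [sub_mul, Finset.sum_sub_distrib, ← Finset.mul_sum, hw]
  have habs : ε / 2 * ∑ v, |t v| = ∑ v, (ε / 2 * |t v| - ε / 2 * t v) + ε / 2 * ∑ v, t v := by
    rw [Finset.sum_sub_distrib, Finset.mul_sum, Finset.mul_sum]; ring
  rw [hgap, habs, ht, mul_zero, add_zero]
  refine Finset.sum_le_sum fun v _ => ?_
  have hbound : ε * (M - t v) ≤ (M - t v) * w v := by
    rw [mul_comm]
    exact mul_le_mul_of_nonneg_left (hεw v) (sub_nonneg.2 (hM v))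
  refine le_trans ?_ hbound
  rcases abs_cases (t v) with ⟨h, _⟩ | ⟨h, _⟩ <;> rw [h] <;> nlinarith [hM v]

/-- The key inequality bounding the noise from below: for `x ∈ 𝔇`, `y = π(x)`,
`θ ∈ T𝔇` with `Σ_{i,v} |θ_v^i| = 1`, and `v^i` a vertex maximising `θ^i`,
`[Σ_i max_v θ_v^i - Σ_{i,v} θ_v^i y_v^i]⁺ ∏_i y_{v^i}^i ≥ (1/(2md)) (min_{i,v} y_v^i)^{m+1}`. -/
theorem noise_lower_bound (d m : ℕ) (hd : 2 ≤ d) (hm : 2 ≤ m)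
    (α : Fin d → Fin m → Fin m → ℝ) (hsym : ∀ v i j, α v i j = α v j i)
    (x : Fin m → Fin d → ℝ) (hx : x ∈ simplexD d m)
    (y : Fin m → Fin d → ℝ) (hy : y = piMap d m α x)
    (θ : Fin m → Fin d → ℝ)
    (hθtangent : ∀ i, ∑ v, θ i v = 0)
    (hθnorm : ∑ i, ∑ v, |θ i v| = 1)
    (vsel : Fin m → Fin d) (hvsel : ∀ i v, θ i v ≤ θ i (vsel i)) :
    (1 / (2 * (m : ℝ) * (d : ℝ))) * (⨅ p : Fin m × Fin d, y p.1 p.2) ^ (m + 1) ≤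
      max (∑ i, θ i (vsel i) - ∑ i, ∑ v, θ i v * y i v) 0 * ∏ i, y i (vsel i) := by
  have hpos : ∀ i v, 0 < y i v := fun i v => hy ▸ piMap_pos α x i v
  have : NeZero d := ⟨by omega⟩
  have hsum : ∀ i, ∑ v, y i v = 1 := fun i => hy ▸ sum_piMap α x i
  set ε := ⨅ p : Fin m × Fin d, y p.1 p.2
  have hε : 0 ≤ ε := Real.iInf_nonneg fun p => (hpos p.1 p.2).le
  have hεy : ∀ i v, ε ≤ y i v := fun i v =>
    ciInf_le (Set.finite_range fun p : Fin m × Fin d => y p.1 p.2).bddBelow (i, v)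
  have hgap : ε / 2 ≤ ∑ i, θ i (vsel i) - ∑ i, ∑ v, θ i v * y i v := by
    calc ε / 2 = ∑ i, ε / 2 * ∑ v, |θ i v| := by rw [← Finset.mul_sum, hθnorm, mul_one]
      _ ≤ ∑ i, (θ i (vsel i) - ∑ v, θ i v * y i v) := Finset.sum_le_sum fun i _ =>
          half_mul_sum_abs_le_sub_sum_mul (hθtangent i) (hvsel i) (hsum i) hε (hεy i)
      _ = _ := Finset.sum_sub_distrib _ _
  have hprod : ε ^ m ≤ ∏ i, y i (vsel i) := by
    simpa using Finset.prod_le_prod (s := Finset.univ) (fun _ _ => hε)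
      fun i _ => hεy i (vsel i)
  have hcoef : 1 / (2 * (m : ℝ) * (d : ℝ)) ≤ 1 / 2 := by
    have hm' : (2 : ℝ) ≤ m := by exact_mod_cast hm
    have hd' : (2 : ℝ) ≤ d := by exact_mod_cast hd
    exact one_div_le_one_div_of_le two_pos (by nlinarith)
  calc 1 / (2 * (m : ℝ) * (d : ℝ)) * ε ^ (m + 1) ≤ 1 / 2 * ε ^ (m + 1) := by gcongr
    _ = ε / 2 * ε ^ m := by ring
    _ ≤ _ := mul_le_mul (hgap.trans (le_max_left _ _)) hprod (by positivity) (le_max_right _ _)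
end

section
/- There exists β_0 > 2 such that for every β ≥ β_0 there is a unique w_β ∈ (0, 1/β³) satisfying w_β = 1 / (1 + e^{2β(1/2 − w_β)}). -/
/-- The map `w ↦ w * exp (β - 2βw)` is monotone below `1/(2β)`. -/
lemma mul_exp_le_mul_exp {β a b : ℝ} (hb : 0 ≤ b) (hab : a ≤ b) (hβb : 2 * β * b ≤ 1) :
    a * Real.exp (2 * β * (1 / 2 - a)) ≤ b * Real.exp (2 * β * (1 / 2 - b)) := by
  have hsplit : Real.exp (2 * β * (1 / 2 - b)) =
      Real.exp (-(2 * β * (b - a))) * Real.exp (2 * β * (1 / 2 - a)) := by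
    rw [← Real.exp_add]
    ring_nf
  have hexp : 1 - 2 * β * (b - a) ≤ Real.exp (-(2 * β * (b - a))) :=
    Real.one_sub_le_exp_neg _
  rw [hsplit, ← mul_assoc]
  refine mul_le_mul_of_nonneg_right ?_ (Real.exp_pos _).le
  have h₁ := mul_le_mul_of_nonneg_left hexp hb
  have h₂ := mul_le_mul_of_nonneg_right hβb (sub_nonneg.2 hab)
  linarith

lemma cube_le_exp_half {β : ℝ} (hβ : 400 ≤ β) : β ^ 3 ≤ Real.exp (β / 2) := by
  have h := Real.pow_div_factorial_le_exp (β / 2) (by linarith) 4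
  refine le_trans ?_ h
  have h3 : 0 ≤ β ^ 3 := by positivity
  norm_num [Nat.factorial]
  nlinarith [mul_le_mul_of_nonneg_left hβ h3]

lemma eq_one_div_one_add_exp_iff (w x : ℝ) :
    w = 1 / (1 + Real.exp x) ↔ w + w * Real.exp x = 1 := by
  have h : 1 + Real.exp x ≠ 0 := by positivity
  rw [eq_div_iff h, mul_add, mul_one]

/-- There exists `β₀ > 2` such that for every `β ≥ β₀` there is a unique
`w ∈ (0, 1/β³)` satisfying `w = 1/(1 + e^{2β(1/2 - w)})`. -/
theorem exists_unique_w_beta :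
    ∃ β₀ : ℝ, 2 < β₀ ∧ ∀ β : ℝ, β₀ ≤ β →
      ∃! w : ℝ, w ∈ Set.Ioo (0 : ℝ) (1 / β ^ 3) ∧
        w = 1 / (1 + Real.exp (2 * β * (1 / 2 - w))) := by
  refine ⟨400, by norm_num, fun β hβ => ?_⟩
  simp only [eq_one_div_one_add_exp_iff]
  have hβ0 : 0 < β := by linarith
  have hc : 0 < 1 / β ^ 3 := by positivity
  have hsmall : 2 * β * (1 / β ^ 3) ≤ 1 := by
    rw [mul_one_div, div_le_one (by positivity)]
    nlinarith [mul_le_mul_of_nonneg_left hβ (sq_nonneg β), mul_le_mul_of_nonneg_left hβ hβ0.le]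
  have hle : ∀ w ∈ Set.Ioo (0 : ℝ) (1 / β ^ 3), 2 * β * w ≤ 1 := fun w hw =>
    (mul_le_mul_of_nonneg_left hw.2.le (by positivity)).trans hsmall
  refine existsUnique_of_exists_of_unique ?_ ?_
  · have hcont : ContinuousOn (fun w : ℝ => w + w * Real.exp (2 * β * (1 / 2 - w)))
        (Set.Icc 0 (1 / β ^ 3)) := by fun_prop
    have hend : 1 < 1 / β ^ 3 + 1 / β ^ 3 * Real.exp (2 * β * (1 / 2 - 1 / β ^ 3)) := by
      have hexp : β ^ 3 ≤ Real.exp (2 * β * (1 / 2 - 1 / β ^ 3)) :=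
        (cube_le_exp_half hβ).trans (Real.exp_le_exp.2 (by linarith))
      have h := mul_le_mul_of_nonneg_left hexp hc.le
      rw [one_div_mul_cancel (by positivity)] at h
      linarith
    exact intermediate_value_Ioo hc.le hcont ⟨by simp, hend⟩
  · rintro a b ⟨ha, ha'⟩ ⟨hb, hb'⟩
    rcases lt_trichotomy a b with h | h | h
    · linarith [mul_exp_le_mul_exp hb.1.le h.le (hle b hb)]
    · exact h
    · linarith [mul_exp_le_mul_exp ha.1.le h.le (hle a ha)]
end

section
/- Let m = 3, d = 2, and for β ≥ 0 set α_v^{ij} = −β for i ≠ j and α_v^{ii} = 0 (v ∈ {1,2}, i,j ∈ {1,2,3}). There exists β_0 > 2 such that for all β ≥ β_0 the following hold: with w_β the unique point of (0, 1/β³) satisfying w_β = 1/(1 + e^{2β(1/2 − w_β)}), every point x = (a, 1−a, b, 1−b, c, 1−c) ∈ 𝔇 with {a, b, c} = {1/2, w_β, 1−w_β} (a, b, c pairwise distinct) is an equilibrium point of F, and every such x is linearly stable, i.e. all eigenvalues of the Jacobian matrix JF(x) have negative real part. -/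
noncomputable def FF (d m : ℕ) (α : Fin d → Fin m → Fin m → ℝ)
    (x : Fin m → Fin d → ℝ) : Fin m → Fin d → ℝ :=
  fun i v => -(x i v) + piMap d m α x i v

/-- The Jacobian matrix of `F` at `x`. -/
noncomputable def JF (d m : ℕ) (α : Fin d → Fin m → Fin m → ℝ)
    (x : Fin m → Fin d → ℝ) : Matrix (Fin m × Fin d) (Fin m × Fin d) ℝ :=
  Matrix.of fun p q =>
    fderiv ℝ (fun y => FF d m α y p.1 p.2) x (Pi.single q.1 (Pi.single q.2 (1 : ℝ)))

/-- `x` is linearly stable: every eigenvalue of `JF(x)` has negative real part. -/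
noncomputable def LinStable (d m : ℕ) (α : Fin d → Fin m → Fin m → ℝ)
    (x : Fin m → Fin d → ℝ) : Prop :=
  ∀ μ ∈ spectrum ℂ ((JF d m α x).map (algebraMap ℝ ℂ)), μ.re < 0

/-- The repelling interaction strengths for three walks on the two-vertex graph:
`α_v^{ij} = -β` for `i ≠ j` and `α_v^{ii} = 0`. -/
noncomputable def alphaRep (β : ℝ) : Fin 2 → Fin 3 → Fin 3 → ℝ :=
  fun _ i j => if i = j then 0 else -β

open Matrix in
/-- A complex number in the spectrum of a matrix has an eigenvector. -/
lemma exists_mulVec_eq_smul_of_mem_spectrum {ι : Type*} [Fintype ι] [DecidableEq ι]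
    {M : Matrix ι ι ℂ} {μ : ℂ} (hμ : μ ∈ spectrum ℂ M) :
    ∃ z : ι → ℂ, z ≠ 0 ∧ M *ᵥ z = μ • z := by
  rw [← Matrix.spectrum_toLin', ← Module.End.hasEigenvalue_iff_mem_spectrum] at hμ
  obtain ⟨z, hz⟩ := hμ.exists_hasEigenvector
  exact ⟨z, hz.2, by simpa using hz.apply_eq_smul⟩

/-- The entries of the Jacobian matrix of `F` in terms of `π`. -/
lemma JF_apply {d m : ℕ} (α : Fin d → Fin m → Fin m → ℝ) (x : Fin m → Fin d → ℝ)
    (i j : Fin m) (v u : Fin d) :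
    JF d m α x (i, v) (j, u) = -(if i = j ∧ v = u then 1 else 0) +
      piMap d m α x i v * ((if v = u then α v i j else 0) - piMap d m α x i u * α u i j) := by
  let c : Fin m → Fin d → (Fin m → Fin d → ℝ) →L[ℝ] ℝ := fun k w =>
    (ContinuousLinearMap.proj (R := ℝ) (φ := fun _ : Fin d => ℝ) w).comp
      (ContinuousLinearMap.proj (R := ℝ) (φ := fun _ : Fin m => Fin d → ℝ) k)
  let L : Fin d → (Fin m → Fin d → ℝ) →L[ℝ] ℝ := fun w => ∑ k, α w i k • c k w
  have hL : ∀ w y, L w y = ∑ k, α w i k * y k w := fun w y => by simp [L, c]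
  have hE : ∀ w, HasFDerivAt (fun y => Real.exp (L w y)) (Real.exp (L w x) • L w) x :=
    fun w => (L w).hasFDerivAt.exp
  have hS : HasFDerivAt (fun y => ∑ w, Real.exp (L w y)) (∑ w, Real.exp (L w x) • L w) x :=
    HasFDerivAt.fun_sum fun w _ => hE w
  have hpos : 0 < ∑ w, Real.exp (L w x) :=
    Finset.sum_pos (fun w _ => Real.exp_pos _) ⟨v, Finset.mem_univ v⟩
  have hF := ((c i v).hasFDerivAt (x := x)).fun_neg.fun_add
    ((hE v).fun_mul ((hasDerivAt_inv hpos.ne').comp_hasFDerivAt x hS))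
  have heq : (fun y => FF d m α y i v) =
      fun y => -(c i v y) + Real.exp (L v y) * (Inv.inv ∘ fun y => ∑ w, Real.exp (L w y)) y := by
    funext y
    simp [FF, piMap, hL, c, div_eq_mul_inv]
  have hc : ∀ k w, c k w (Pi.single j (Pi.single u (1 : ℝ))) = if k = j ∧ w = u then 1 else 0 := by
    intro k w
    by_cases hk : k = j
    · subst hk
      simp [c, Pi.single_apply]
    · simp [c, hk]
  have hLs : ∀ w, L w (Pi.single j (Pi.single u (1 : ℝ))) = if w = u then α w i j else 0 := by
    intro w
    by_cases hw : w = u <;> simp [L, hc, hw]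
  have hp : ∀ w, piMap d m α x i w = Real.exp (L w x) / ∑ w, Real.exp (L w x) := by
    intro w
    simp [piMap, hL]
  simp only [JF, Matrix.of_apply]
  rw [heq, hF.fderiv, hp, hp]
  simp only [_root_.add_apply, _root_.neg_apply, _root_.smul_apply,
    _root_.sum_apply, hc, hLs, smul_eq_mul, mul_ite, mul_zero, Finset.sum_ite_eq',
    Finset.mem_univ, if_true, Function.comp_apply]
  split_ifs <;> field_simp <;> ring

/-- A system of linear inequalities between nonnegative reals, each bounded by a multiple of the
sum of the other two, has only the trivial solution if two of the coefficients are small. -/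
lemma eq_zero_of_le_mul_add {K c r s t : ℝ} (hr : 0 ≤ r) (hs : 0 ≤ s) (ht : 0 ≤ t) (hc : 0 ≤ c)
    (hK : c + 2 * c * K < 1) (h₁ : r ≤ K * (s + t)) (h₂ : s ≤ c * (r + t))
    (h₃ : t ≤ c * (r + s)) : r = 0 ∧ s = 0 ∧ t = 0 := by
  have hst : s + t = 0 := by
    have := mul_le_mul_of_nonneg_left h₁ hc
    nlinarith [add_nonneg hs ht]
  have hs0 : s = 0 := by linarith
  have ht0 : t = 0 := by linarith
  refine ⟨?_, hs0, ht0⟩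
  rw [hst, mul_zero] at h₁
  linarith

/-- A two-term softmax is a logistic function. -/
lemma exp_div_exp_add_exp (s t : ℝ) :
    Real.exp s / (Real.exp s + Real.exp t) = 1 / (1 + Real.exp (t - s)) := by
  rw [Real.exp_sub]
  field_simp

/-- The equilibrium equations on the product of simplices, in terms of the first coordinates. -/
lemma FF_alphaRep_eq_zero {β a b c : ℝ}
    (ha : a = 1 / (1 + Real.exp (2 * β * (b + c - 1))))
    (hb : b = 1 / (1 + Real.exp (2 * β * (a + c - 1))))
    (hc : c = 1 / (1 + Real.exp (2 * β * (a + b - 1)))) :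
    FF 2 3 (alphaRep β) ![![a, 1 - a], ![b, 1 - b], ![c, 1 - c]] = 0 := by
  have key : ∀ p s t r : ℝ, p = 1 / (1 + Real.exp r) → t - s = r →
      -p + Real.exp s / (Real.exp s + Real.exp t) = 0 ∧
      -(1 - p) + Real.exp t / (Real.exp s + Real.exp t) = 0 := by
    intro p s t r hp hr
    have h := exp_div_exp_add_exp s t
    rw [hr, ← hp] at h
    have h1 : Real.exp s / (Real.exp s + Real.exp t) +
        Real.exp t / (Real.exp s + Real.exp t) = 1 := by
      rw [← add_div, div_self (by positivity)]
    constructor <;> linarith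
  have ka := key a (-(β * b) + -(β * c)) (-(β * (1 - b)) + -(β * (1 - c))) _ ha (by ring)
  have kb := key b (-(β * a) + -(β * c)) (-(β * (1 - a)) + -(β * (1 - c))) _ hb (by ring)
  have kc := key c (-(β * a) + -(β * b)) (-(β * (1 - a)) + -(β * (1 - b))) _ hc (by ring)
  funext i v
  fin_cases i <;> fin_cases v
  · simpa [FF, piMap, alphaRep, Fin.sum_univ_three, Fin.sum_univ_two] using ka.1
  · simpa [FF, piMap, alphaRep, Fin.sum_univ_three, Fin.sum_univ_two] using ka.2
  · simpa [FF, piMap, alphaRep, Fin.sum_univ_three, Fin.sum_univ_two] using kb.1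
  · simpa [FF, piMap, alphaRep, Fin.sum_univ_three, Fin.sum_univ_two] using kb.2
  · simpa [FF, piMap, alphaRep, Fin.sum_univ_three, Fin.sum_univ_two] using kc.1
  · simpa [FF, piMap, alphaRep, Fin.sum_univ_three, Fin.sum_univ_two] using kc.2

/-- An equilibrium is linearly stable as soon as the linear inequalities satisfied by the moduli
of the components of an unstable eigenvector have no nontrivial solution. -/
lemma linStable_alphaRep {β a b c : ℝ} (hβ : 0 ≤ β)
    (ha : 0 ≤ a * (1 - a)) (hb : 0 ≤ b * (1 - b)) (hc : 0 ≤ c * (1 - c))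
    (hF : FF 2 3 (alphaRep β) ![![a, 1 - a], ![b, 1 - b], ![c, 1 - c]] = 0)
    (h : ∀ r s t : ℝ, 0 ≤ r → 0 ≤ s → 0 ≤ t → r ≤ 2 * β * (a * (1 - a)) * (s + t) →
      s ≤ 2 * β * (b * (1 - b)) * (r + t) → t ≤ 2 * β * (c * (1 - c)) * (r + s) →
      r = 0 ∧ s = 0 ∧ t = 0) :
    LinStable 2 3 (alphaRep β) ![![a, 1 - a], ![b, 1 - b], ![c, 1 - c]] := by
  intro μ hμ
  obtain ⟨z, hz0, hz⟩ := exists_mulVec_eq_smul_of_mem_spectrum hμ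
  by_contra! hre
  apply hz0
  set x : Fin 3 → Fin 2 → ℝ := ![![a, 1 - a], ![b, 1 - b], ![c, 1 - c]] with hx
  have hp : ∀ i v, piMap 2 3 (alphaRep β) x i v = x i v := by
    intro i v
    have := congrFun (congrFun hF i) v
    simp only [FF, Pi.zero_apply] at this
    linarith
  have hrow : ∀ i v, ∑ j, ∑ u, ((-(if i = j ∧ v = u then 1 else 0) +
      x i v * ((if v = u then alphaRep β v i j else 0) - x i u * alphaRep β u i j) : ℝ) : ℂ)
        * z (j, u) = μ * z (i, v) := by
    intro i v
    have := congrFun hz (i, v)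
    simpa only [Matrix.mulVec, dotProduct, Fintype.sum_prod_type, Matrix.map_apply, JF_apply, hp,
      Pi.smul_apply, smul_eq_mul, Complex.coe_algebraMap] using this
  have e00 := hrow 0 0
  have e01 := hrow 0 1
  have e10 := hrow 1 0
  have e11 := hrow 1 1
  have e20 := hrow 2 0
  have e21 := hrow 2 1
  simp [Fin.sum_univ_three, Fin.sum_univ_two, alphaRep, hx] at e00 e01 e10 e11 e20 e21
  have hμ1 : 1 ≤ ‖μ + 1‖ := by
    refine le_trans ?_ (Complex.re_le_norm _)
    simp [hre]
  have hμ0 : μ + 1 ≠ 0 := norm_pos_iff.mp (by linarith)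
  have bound : ∀ (q : ℝ) (y₁ y₂ y₃ : ℂ), 0 ≤ q * (1 - q) →
      (μ + 1) * y₁ = -((2 * β * (q * (1 - q)) : ℝ) : ℂ) * (y₂ + y₃) →
      ‖y₁‖ ≤ 2 * β * (q * (1 - q)) * (‖y₂‖ + ‖y₃‖) := by
    intro q y₁ y₂ y₃ hq hy
    have hn := congrArg norm hy
    rw [norm_mul, norm_mul, norm_neg, Complex.norm_real, Real.norm_of_nonneg (by positivity)] at hn
    calc ‖y₁‖ ≤ ‖μ + 1‖ * ‖y₁‖ := le_mul_of_one_le_left (norm_nonneg _) hμ1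
      _ ≤ _ := hn.trans_le (mul_le_mul_of_nonneg_left (norm_add_le _ _) (by positivity))
  obtain ⟨h0, h1, h2⟩ := h ‖z (0, 0) - z (0, 1)‖ ‖z (1, 0) - z (1, 1)‖ ‖z (2, 0) - z (2, 1)‖
    (norm_nonneg _) (norm_nonneg _) (norm_nonneg _)
    (bound a _ _ _ ha (by push_cast; linear_combination e01 - e00))
    (bound b _ _ _ hb (by push_cast; linear_combination e11 - e10))
    (bound c _ _ _ hc (by push_cast; linear_combination e21 - e20))
  have d0 := norm_eq_zero.mp h0
  have d1 := norm_eq_zero.mp h1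
  have d2 := norm_eq_zero.mp h2
  funext ⟨i, v⟩
  refine (mul_eq_zero.mp (?_ : (μ + 1) * z (i, v) = 0)).resolve_left hμ0
  fin_cases i <;> fin_cases v
  · show (μ + 1) * z (0, 0) = 0
    linear_combination -e00 - β * a * (1 - a) * (d1 + d2)
  · show (μ + 1) * z (0, 1) = 0
    linear_combination -e01 + β * a * (1 - a) * (d1 + d2)
  · show (μ + 1) * z (1, 0) = 0
    linear_combination -e10 - β * b * (1 - b) * (d0 + d2)
  · show (μ + 1) * z (1, 1) = 0
    linear_combination -e11 + β * b * (1 - b) * (d0 + d2)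
  · show (μ + 1) * z (2, 0) = 0
    linear_combination -e20 - β * c * (1 - c) * (d0 + d1)
  · show (μ + 1) * z (2, 1) = 0
    linear_combination -e21 + β * c * (1 - c) * (d0 + d1)

/-- For three repelling walks on the two-vertex graph, there is `β₀ > 2` such that for
all `β ≥ β₀`, with `w_β` the unique point of `(0, 1/β³)` with
`w_β = 1/(1 + e^{2β(1/2 - w_β)})`, every point `(a, 1-a, b, 1-b, c, 1-c)` with
`{a,b,c} = {1/2, w_β, 1-w_β}` pairwise distinct is a linearly stable equilibrium
point of `F`. -/
theorem stable_equilibria_three_walks :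
    ∃ β₀ : ℝ, 2 < β₀ ∧ ∀ β : ℝ, β₀ ≤ β →
      ∀ w : ℝ, w ∈ Set.Ioo (0 : ℝ) (1 / β ^ 3) →
        w = 1 / (1 + Real.exp (2 * β * (1 / 2 - w))) →
      ∀ a b c : ℝ, ({a, b, c} : Set ℝ) = {1 / 2, w, 1 - w} →
        a ≠ b → b ≠ c → a ≠ c →
        (![![a, 1 - a], ![b, 1 - b], ![c, 1 - c]] : Fin 3 → Fin 2 → ℝ) ∈ simplexD 2 3 ∧
        FF 2 3 (alphaRep β) ![![a, 1 - a], ![b, 1 - b], ![c, 1 - c]] = 0 ∧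
        LinStable 2 3 (alphaRep β) ![![a, 1 - a], ![b, 1 - b], ![c, 1 - c]] := by
  refine ⟨4, by norm_num, fun β hβ w ⟨hw0, hw3⟩ hw a b c hS hab hbc hac => ?_⟩
  have hβ0 : 0 < β := by linarith
  have hwβ : w * β ^ 3 < 1 := (lt_div_iff₀ (by positivity)).mp hw3
  have hβ2 : 16 ≤ β ^ 2 := by nlinarith
  have hwβ2 : w * β ^ 2 < 1 / 4 := by
    nlinarith [mul_nonneg (mul_nonneg hw0.le (sq_nonneg β)) (sub_nonneg.mpr hβ)]
  have hwβ1 : w * β < 1 / 16 := by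
    nlinarith [mul_nonneg (mul_nonneg hw0.le hβ0.le) (sub_nonneg.mpr hβ)]
  have hw1 : w < 1 := by
    nlinarith [mul_nonneg hw0.le (sub_nonneg.mpr hβ)]
  have hs : 0 ≤ w * (1 - w) := mul_nonneg hw0.le (by linarith)
  have hc0 : 0 ≤ 2 * β * (w * (1 - w)) := by positivity
  have hK : 2 * β * (w * (1 - w)) + 2 * (2 * β * (w * (1 - w))) * (β / 2) < 1 := by
    nlinarith [mul_nonneg hβ0.le (sq_nonneg w), sq_nonneg (β * w)]
  have hw' : 1 - w = 1 / (1 + Real.exp (-(2 * β * (1 / 2 - w)))) := by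
    rw [Real.exp_neg]
    nth_rewrite 1 [hw]
    field_simp
    ring
  have hmem : ∀ p ∈ ({a, b, c} : Set ℝ), p = 1 / 2 ∨ p = w ∨ p = 1 - w := by
    intro p hp
    rw [hS] at hp
    simpa using hp
  have hI : ∀ p ∈ ({a, b, c} : Set ℝ), 0 ≤ p ∧ 0 ≤ 1 - p := by
    intro p hp
    rcases hmem p hp with rfl | rfl | rfl <;> constructor <;> linarith
  have hIa := hI a (by simp)
  have hIb := hI b (by simp)
  have hIc := hI c (by simp)
  have hF : FF 2 3 (alphaRep β) ![![a, 1 - a], ![b, 1 - b], ![c, 1 - c]] = 0 := by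
    have hhalf : ∀ r : ℝ, r = 0 → (1 / 2 : ℝ) = 1 / (1 + Real.exp r) := by
      rintro r rfl
      norm_num
    have hlow : ∀ r : ℝ, r = 2 * β * (1 / 2 - w) → w = 1 / (1 + Real.exp r) := by
      rintro r rfl
      exact hw
    have hhigh : ∀ r : ℝ, r = -(2 * β * (1 / 2 - w)) → 1 - w = 1 / (1 + Real.exp r) := by
      rintro r rfl
      exact hw'
    apply FF_alphaRep_eq_zero <;>
    rcases hmem a (by simp) with ha | ha | ha <;>
    rcases hmem b (by simp) with hb | hb | hb <;>
    rcases hmem c (by simp) with hc | hc | hc <;>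
    first
    | exact absurd (ha.trans hb.symm) hab
    | exact absurd (hb.trans hc.symm) hbc
    | exact absurd (ha.trans hc.symm) hac
    | (rw [ha, hb, hc]
       first
       | exact hhalf _ (by ring)
       | exact hlow _ (by ring)
       | exact hhigh _ (by ring))
  refine ⟨?_, hF, ?_⟩
  · intro i
    refine ⟨fun v => ?_, ?_⟩
    · fin_cases i <;> fin_cases v <;> simp <;> linarith
    · fin_cases i <;> simp
  · refine linStable_alphaRep hβ0.le (mul_nonneg hIa.1 hIa.2) (mul_nonneg hIb.1 hIb.2)
      (mul_nonneg hIc.1 hIc.2) hF fun r s t hr hs ht h₁ h₂ h₃ => ?_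
    have hhalf : ∀ p q y : ℝ, p = 1 / 2 → q ≤ 2 * β * (p * (1 - p)) * y → q ≤ β / 2 * y := by
      rintro p q y rfl h
      linarith
    have hsmall : ∀ p q y : ℝ, p = w ∨ p = 1 - w → q ≤ 2 * β * (p * (1 - p)) * y →
        q ≤ 2 * β * (w * (1 - w)) * y := by
      rintro p q y (rfl | rfl) h <;> linarith
    rcases hmem a (by simp) with ha | ha
    · have hb := (hmem b (by simp)).resolve_left fun hb => hab (ha.trans hb.symm)
      have hc := (hmem c (by simp)).resolve_left fun hc => hac (ha.trans hc.symm)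
      exact eq_zero_of_le_mul_add hr hs ht hc0 hK (hhalf _ _ _ ha h₁) (hsmall _ _ _ hb h₂)
        (hsmall _ _ _ hc h₃)
    · rcases hmem b (by simp) with hb | hb
      · have hc := (hmem c (by simp)).resolve_left fun hc => hbc (hb.trans hc.symm)
        have := eq_zero_of_le_mul_add hs hr ht hc0 hK (hhalf _ _ _ hb h₂) (hsmall _ _ _ ha h₁)
          (by simpa [add_comm] using hsmall _ _ _ hc h₃)
        tauto
      · have hc : c = 1 / 2 := by
          have hm : (1 / 2 : ℝ) ∈ ({a, b, c} : Set ℝ) := by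
            rw [hS]
            simp
          have hw2 : w < 1 / 2 := by nlinarith
          rcases hm with h | h | h
          · rcases ha with ha | ha <;> linarith
          · rcases hb with hb | hb <;> linarith
          · exact h.symm
        have := eq_zero_of_le_mul_add ht hr hs hc0 hK (hhalf _ _ _ hc h₃)
          (by simpa [add_comm] using hsmall _ _ _ ha h₁)
          (by simpa [add_comm] using hsmall _ _ _ hb h₂)
        tauto
end
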